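/- Consider site percolation on ℤ² with parameter p satisfying p_c < p ≤ 1. Then there exist a constant C > 0 and n₀ ∈ ℕ such that for all integers n ≥ n₀, the P_p-probability that the box {0,…,n} × {0,…,n} contains an open cluster (within the box) with at least n sites is at least 1 − exp(−C·n). -/

import Mathlib

open MeasureTheory
open scoped ENNReal

/-- Configurations of site percolation on `ℤ²`: `true` = open (black). -/
abbrev Config : Type := ℤ × ℤ → Bool

/-- Two sites of `ℤ²` are adjacent iff `|v₁ − w₁| + |v₂ − w₂| = 1`. -/
def Adjacent (v w : ℤ × ℤ) : Prop := |v.1 - w.1| + |v.2 - w.2| = 1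

/-- `OpenConn ω S v w` : there is a path of adjacent open sites staying in `S`
joining `v` to `w` (in the configuration `ω`). -/
def OpenConn (ω : Config) (S : Set (ℤ × ℤ)) : ℤ × ℤ → ℤ × ℤ → Prop :=
  Relation.ReflTransGen fun a b => Adjacent a b ∧ b ∈ S ∧ ω b = true

/-- The open cluster of the site `v` within the region `S`, in the configuration `ω`:
the set of open sites of `S` joined to `v` by a path of adjacent open sites staying in
`S`. It is empty if `v` is closed or `v ∉ S`. -/
def cluster (ω : Config) (S : Set (ℤ × ℤ)) (v : ℤ × ℤ) : Set (ℤ × ℤ) :=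
  {w | v ∈ S ∧ ω v = true ∧ OpenConn ω S v w}

/-- `IsBernoulliProduct p μ` : `μ` is the product measure on configurations under which
each site of `ℤ²` is independently open with probability `p`. -/
def IsBernoulliProduct (p : ℝ) (μ : Measure Config) : Prop :=
  IsProbabilityMeasure μ ∧
    ∀ (s : Finset (ℤ × ℤ)) (f : (ℤ × ℤ) → Bool),
      μ {ω | ∀ v ∈ s, ω v = f v} =
        ∏ v ∈ s, ENNReal.ofReal (if f v then p else 1 - p)

/-- The critical probability `p_c` of site percolation on `ℤ²`:
`p_c = sSup {p ∈ [0,1] : P_p(|C(0,0)| = ∞) = 0}`. -/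
noncomputable def siteCriticalProbability : ℝ :=
  sSup {p : ℝ | p ∈ Set.Icc (0 : ℝ) 1 ∧
    ∀ μ : Measure Config, IsBernoulliProduct p μ →
      μ {ω | (cluster ω Set.univ (0, 0)).Infinite} = 0}

/-- The `N × N` box `{1,…,N} × {1,…,N}` in `ℤ²` (the pixel screen). -/
def box (N : ℕ) : Set (ℤ × ℤ) :=
  {v | 1 ≤ v.1 ∧ v.1 ≤ (N : ℤ) ∧ 1 ≤ v.2 ∧ v.2 ≤ (N : ℤ)}

/-- The box `{0,…,n} × {0,…,n}` in `ℤ²`. -/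
def box0 (n : ℕ) : Set (ℤ × ℤ) :=
  {v | 0 ≤ v.1 ∧ v.1 ≤ (n : ℤ) ∧ 0 ≤ v.2 ∧ v.2 ≤ (n : ℤ)}

namespace Perc

/-- `Conn ω S v w`: `v` and `w` are open sites of `S` joined by an open path in `S`. -/
def Conn (ω : Config) (S : Set (ℤ × ℤ)) (v w : ℤ × ℤ) : Prop :=
  v ∈ S ∧ ω v = true ∧ OpenConn ω S v w

theorem Conn.refl {ω : Config} {S : Set (ℤ × ℤ)} {v : ℤ × ℤ} (h : v ∈ S) (h' : ω v = true) :
    Conn ω S v v := ⟨h, h', Relation.ReflTransGen.refl⟩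

theorem Conn.tail {ω : Config} {S : Set (ℤ × ℤ)} {v w z : ℤ × ℤ} (h : Conn ω S v w)
    (ha : Adjacent w z) (hz : z ∈ S) (hz' : ω z = true) : Conn ω S v z :=
  ⟨h.1, h.2.1, Relation.ReflTransGen.tail h.2.2 ⟨ha, hz, hz'⟩⟩

theorem Conn.trans {ω : Config} {S : Set (ℤ × ℤ)} {v w z : ℤ × ℤ} (h : Conn ω S v w)
    (h2 : Conn ω S w z) : Conn ω S v z :=
  ⟨h.1, h.2.1, Relation.ReflTransGen.trans h.2.2 h2.2.2⟩

theorem Conn.induct {ω : Config} {S : Set (ℤ × ℤ)} {v w : ℤ × ℤ} (h : Conn ω S v w)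
    (Q : ℤ × ℤ → Prop) (h0 : Q v)
    (hs : ∀ b c, Conn ω S v b → Adjacent b c → c ∈ S → ω c = true → Q b → Q c) : Q w := by
  obtain ⟨h1, h2, h3⟩ := h
  unfold OpenConn at h3
  induction h3 with
  | refl => exact h0
  | tail hb hc ih => exact hs _ _ ⟨h1, h2, hb⟩ hc.1 hc.2.1 hc.2.2 ih

theorem Conn.right {ω : Config} {S : Set (ℤ × ℤ)} {v w : ℤ × ℤ} (h : Conn ω S v w) :
    w ∈ S ∧ ω w = true :=
  h.induct (fun w => w ∈ S ∧ ω w = true) ⟨h.1, h.2.1⟩ (fun _ _ _ _ h1 h2 _ => ⟨h1, h2⟩)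

theorem Adjacent.symm' {v w : ℤ × ℤ} (h : Adjacent v w) : Adjacent w v := by
  unfold Adjacent at *
  rw [abs_sub_comm w.1, abs_sub_comm w.2]; exact h

theorem Conn.symm {ω : Config} {S : Set (ℤ × ℤ)} {v w : ℤ × ℤ} (h : Conn ω S v w) :
    Conn ω S w v := by
  refine h.induct (fun w => Conn ω S w v) (Conn.refl h.1 h.2.1) ?_
  intro b c hb ha hc hc' ih
  exact ((Conn.refl hc hc').tail (Adjacent.symm' ha) hb.right.1 hb.right.2).trans ih

theorem Conn.mono {ω ω' : Config} {S T : Set (ℤ × ℤ)} {v w : ℤ × ℤ} (h : Conn ω S v w)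
    (hST : S ⊆ T) (hω : ∀ z ∈ S, ω z = true → ω' z = true) : Conn ω' T v w := by
  refine h.induct (fun w => Conn ω' T v w) (Conn.refl (hST h.1) (hω _ h.1 h.2.1)) ?_
  intro b c _ ha hc hc' ih
  exact ih.tail ha (hST hc) (hω _ hc hc')

theorem Conn.path {ω : Config} {S : Set (ℤ × ℤ)} {v w : ℤ × ℤ} (h : Conn ω S v w) :
    ∃ (n : ℕ) (f : ℕ → ℤ × ℤ), f 0 = v ∧ f n = w ∧ (∀ i, i ≤ n → Conn ω S v (f i)) ∧
      ∀ i, i < n → Adjacent (f i) (f (i + 1)) := by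
  refine h.induct (fun w => ∃ (n : ℕ) (f : ℕ → ℤ × ℤ), f 0 = v ∧ f n = w ∧
    (∀ i, i ≤ n → Conn ω S v (f i)) ∧ ∀ i, i < n → Adjacent (f i) (f (i + 1))) ?_ ?_
  · exact ⟨0, fun _ => v, rfl, rfl, fun _ _ => Conn.refl h.1 h.2.1, by simp⟩
  · rintro b c hb ha hc hc' ⟨n, f, h0, hn, h1, h2⟩
    refine ⟨n + 1, fun i => if i ≤ n then f i else c, by simp [h0], by simp, ?_, ?_⟩
    · intro i hi
      by_cases h : i ≤ n
      · simp only [h, if_true]; exact h1 i h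
      · simp only [h, if_false]; exact hb.tail ha hc hc'
    · intro i hi
      by_cases h : i + 1 ≤ n
      · simp only [h, show i ≤ n by omega, if_true]; exact h2 i (by omega)
      · have : i = n := by omega
        subst this
        simp [hn, ha]

/-- Rectangle of sites. -/
def rect (a b c d : ℤ) : Set (ℤ × ℤ) := {v | a ≤ v.1 ∧ v.1 ≤ b ∧ c ≤ v.2 ∧ v.2 ≤ d}

theorem mem_rect {a b c d : ℤ} {v : ℤ × ℤ} :
    v ∈ rect a b c d ↔ a ≤ v.1 ∧ v.1 ≤ b ∧ c ≤ v.2 ∧ v.2 ≤ d := Iff.rfl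

/-- cutting a path between two levels of a 1-Lipschitz function -/
theorem Conn.cut {ω : Config} {S : Set (ℤ × ℤ)} {v w : ℤ × ℤ} (h : Conn ω S v w)
    (φ : ℤ × ℤ → ℤ) (hφ : ∀ a b, Adjacent a b → |φ a - φ b| ≤ 1) {l r : ℤ} (hlr : l ≤ r)
    (hv : φ v ≤ l) (hw : r ≤ φ w) :
    ∃ a b, φ a = l ∧ φ b = r ∧ Conn ω (S ∩ {z | l ≤ φ z ∧ φ z ≤ r}) a b := by
  by_contra hcon
  have key : φ w < l ∨ (φ w ≤ r ∧ ∃ a, φ a = l ∧ Conn ω (S ∩ {z | l ≤ φ z ∧ φ z ≤ r}) a w) := by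
    refine h.induct (fun w => φ w < l ∨
      (φ w ≤ r ∧ ∃ a, φ a = l ∧ Conn ω (S ∩ {z | l ≤ φ z ∧ φ z ≤ r}) a w)) ?_ ?_
    · rcases lt_or_eq_of_le hv with h1 | h1
      · exact Or.inl h1
      · exact Or.inr ⟨by omega, v, h1, Conn.refl ⟨h.1, by simp; omega⟩ h.2.1⟩
    · intro b c hb ha hc hc' ih
      have hl := abs_le.1 (hφ b c ha)
      rcases ih with ih | ⟨h1, a, h2, h3⟩
      · rcases lt_or_ge (φ c) l with h4 | h4
        · exact Or.inl h4
        · exact Or.inr ⟨by omega, c, by omega, Conn.refl ⟨hc, by simp; omega⟩ hc'⟩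
      · rcases lt_or_ge (φ c) l with h4 | h4
        · exact Or.inl h4
        · rcases le_or_gt (φ c) r with h5 | h5
          · exact Or.inr ⟨h5, a, h2, h3.tail ha ⟨hc, by simp; omega⟩ hc'⟩
          · exact absurd ⟨a, b, h2, by omega, h3⟩ hcon
  rcases key with h1 | ⟨h1, a, h2, h3⟩
  · omega
  · exact hcon ⟨a, w, h2, by omega, h3⟩

theorem lip_fst (a b : ℤ × ℤ) (h : Adjacent a b) : |a.1 - b.1| ≤ 1 := by
  unfold Adjacent at h; have := abs_nonneg (a.2 - b.2); omega

theorem lip_snd (a b : ℤ × ℤ) (h : Adjacent a b) : |a.2 - b.2| ≤ 1 := by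
  unfold Adjacent at h; have := abs_nonneg (a.1 - b.1); omega

/-- sup norm -/
def sn (v : ℤ × ℤ) : ℤ := max |v.1| |v.2|

theorem lip_sn (a b : ℤ × ℤ) (h : Adjacent a b) : |sn a - sn b| ≤ 1 := by
  have h1 := lip_fst a b h
  have h2 := lip_snd a b h
  unfold sn
  refine (abs_max_sub_max_le_max _ _ _ _).trans (max_le ?_ ?_)
  · exact (abs_abs_sub_abs_le _ _).trans h1
  · exact (abs_abs_sub_abs_le _ _).trans h2

/-! ### The crossing lemma -/

/-- signed crossing number of a step across the half line `{x > 0, 0 < y < 1}` -/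
def wind (d e : ℤ × ℤ) : ℤ :=
  if d.1 = e.1 ∧ 1 ≤ d.1 then
    (if d.2 = 0 ∧ e.2 = 1 then 1 else if d.2 = 1 ∧ e.2 = 0 then -1 else 0) else 0

theorem adj_cases {a b : ℤ × ℤ} (h : Adjacent a b) :
    (b.1 = a.1 + 1 ∧ b.2 = a.2) ∨ (b.1 = a.1 - 1 ∧ b.2 = a.2) ∨
    (b.1 = a.1 ∧ b.2 = a.2 + 1) ∨ (b.1 = a.1 ∧ b.2 = a.2 - 1) := by
  unfold Adjacent at h
  rcases abs_cases (a.1 - b.1) with h1 | h1 <;> rcases abs_cases (a.2 - b.2) with h2 | h2 <;> omega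

set_option maxHeartbeats 4000000 in
theorem wind_cell {a a' b b' : ℤ × ℤ} (ha : Adjacent a a') (hb : Adjacent b b')
    (h1 : a ≠ b) (h2 : a' ≠ b) (h3 : a ≠ b') (h4 : a' ≠ b') :
    wind (a - b) (a' - b) + wind (a' - b) (a' - b') =
      wind (a - b) (a - b') + wind (a - b') (a' - b') := by
  obtain ⟨a1, a2⟩ := a
  obtain ⟨b1, b2⟩ := b
  obtain ⟨c1, c2⟩ := a'
  obtain ⟨d1, d2⟩ := b'
  simp only [ne_eq, Prod.mk.injEq, not_and] at h1 h2 h3 h4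
  have ha := adj_cases ha
  have hb := adj_cases hb
  simp only [] at ha hb
  simp only [wind, Prod.mk_sub_mk]
  rcases ha with ⟨rfl, rfl⟩ | ⟨rfl, rfl⟩ | ⟨rfl, rfl⟩ | ⟨rfl, rfl⟩ <;>
  rcases hb with ⟨rfl, rfl⟩ | ⟨rfl, rfl⟩ | ⟨rfl, rfl⟩ | ⟨rfl, rfl⟩ <;>
  split_ifs <;> omega

open Finset in
theorem wind_row {f : ℕ → ℤ × ℤ} {b b' : ℤ × ℤ} {m : ℕ}
    (hf : ∀ i, i < m → Adjacent (f i) (f (i + 1))) (hb : Adjacent b b')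
    (h1 : ∀ i, i ≤ m → f i ≠ b) (h2 : ∀ i, i ≤ m → f i ≠ b') :
    ∑ i ∈ range m, wind (f i - b) (f (i + 1) - b) + wind (f m - b) (f m - b') =
      wind (f 0 - b) (f 0 - b') + ∑ i ∈ range m, wind (f i - b') (f (i + 1) - b') := by
  induction m with
  | zero => simp
  | succ m ih =>
    have := ih (fun i hi => hf i (by omega)) (fun i hi => h1 i (by omega))
      (fun i hi => h2 i (by omega))
    have h3 := wind_cell (hf m (by omega)) hb (h1 m (by omega)) (h1 (m + 1) (by omega))
      (h2 m (by omega)) (h2 (m + 1) (by omega))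
    rw [sum_range_succ, sum_range_succ]
    linarith

open Finset in
theorem wind_grid {f g : ℕ → ℤ × ℤ} {m n : ℕ}
    (hf : ∀ i, i < m → Adjacent (f i) (f (i + 1)))
    (hg : ∀ i, i < n → Adjacent (g i) (g (i + 1)))
    (h : ∀ i j, i ≤ m → j ≤ n → f i ≠ g j) :
    ∑ i ∈ range m, wind (f i - g 0) (f (i + 1) - g 0) +
      ∑ j ∈ range n, wind (f m - g j) (f m - g (j + 1)) =
    ∑ j ∈ range n, wind (f 0 - g j) (f 0 - g (j + 1)) +
      ∑ i ∈ range m, wind (f i - g n) (f (i + 1) - g n) := by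
  induction n with
  | zero => simp
  | succ n ih =>
    have := ih (fun i hi => hg i (by omega)) (fun i j hi hj => h i j hi (by omega))
    have h3 := wind_row hf (hg n (by omega)) (fun i hi => h i n hi (by omega))
      (fun i hi => h i (n + 1) hi (by omega))
    rw [sum_range_succ _ n, sum_range_succ _ n]
    linarith

theorem sum_wind_zero {D : ℕ → ℤ × ℤ} {m : ℕ}
    (h : ∀ i, i < m → wind (D i) (D (i + 1)) = 0) :
    ∑ i ∈ Finset.range m, wind (D i) (D (i + 1)) = 0 :=
  Finset.sum_eq_zero (fun i hi => h i (Finset.mem_range.1 hi))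

theorem sum_wind_pot {D : ℕ → ℤ × ℤ} {m : ℕ} (φ : ℤ × ℤ → ℤ)
    (h : ∀ i, i < m → wind (D i) (D (i + 1)) = φ (D (i + 1)) - φ (D i)) :
    ∑ i ∈ Finset.range m, wind (D i) (D (i + 1)) = φ (D m) - φ (D 0) := by
  rw [Finset.sum_congr rfl (fun i hi => h i (Finset.mem_range.1 hi))]
  exact Finset.sum_range_sub (fun i => φ (D i)) m

theorem wind_neg {d e : ℤ × ℤ} (h : d.1 ≤ 0) : wind d e = 0 := by
  unfold wind; split_ifs <;> omega

theorem wind_low {d e : ℤ × ℤ} (h : d.2 ≤ 0) (h' : e.2 ≤ 0) : wind d e = 0 := by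
  unfold wind; split_ifs <;> omega

/-- potentials -/
def pot1 (d : ℤ × ℤ) : ℤ := if 1 ≤ d.2 then 1 else 0
def pot2 (d : ℤ × ℤ) : ℤ := if 1 ≤ d.2 ∨ d.1 < 0 then 1 else 0

theorem ne_zero_pair {a b : ℤ × ℤ} (h : a ≠ b) : (a - b).1 ≠ 0 ∨ (a - b).2 ≠ 0 := by
  by_contra hc
  push Not at hc
  apply h
  have h1 : a.1 - b.1 = 0 := hc.1
  have h2 : a.2 - b.2 = 0 := hc.2
  ext <;> omega

theorem wind_pot1 {d e : ℤ × ℤ} (ha : Adjacent d e) (h : 0 ≤ d.1) (h' : 0 ≤ e.1)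
    (hd : d.1 ≠ 0 ∨ d.2 ≠ 0) (he : e.1 ≠ 0 ∨ e.2 ≠ 0) : wind d e = pot1 e - pot1 d := by
  have := adj_cases ha
  unfold wind pot1; split_ifs <;> omega

theorem wind_pot2 {d e : ℤ × ℤ} (ha : Adjacent d e) (h : 0 ≤ d.2) (h' : 0 ≤ e.2)
    (hd : d.1 ≠ 0 ∨ d.2 ≠ 0) (he : e.1 ≠ 0 ∨ e.2 ≠ 0) : wind d e = pot2 e - pot2 d := by
  have := adj_cases ha
  unfold wind pot2; split_ifs <;> omega

theorem adj_sub_right {a b : ℤ × ℤ} (h : Adjacent a b) (c : ℤ × ℤ) :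
    Adjacent (a - c) (b - c) := by
  unfold Adjacent at *; simpa using h

theorem adj_sub_left {a b : ℤ × ℤ} (h : Adjacent a b) (c : ℤ × ℤ) :
    Adjacent (c - a) (c - b) := by
  unfold Adjacent at *
  simp only [Prod.fst_sub, Prod.snd_sub, sub_sub_sub_cancel_left]
  rw [abs_sub_comm b.1, abs_sub_comm b.2]; exact h

/-- vertical and horizontal crossings meet -/
theorem cross_fun {f g : ℕ → ℤ × ℤ} {m n : ℕ}
    (hf : ∀ i, i < m → Adjacent (f i) (f (i + 1)))
    (hg : ∀ i, i < n → Adjacent (g i) (g (i + 1)))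
    (hfx : ∀ i, i ≤ m → (g 0).1 ≤ (f i).1 ∧ (f i).1 ≤ (g n).1)
    (hgy : ∀ j, j ≤ n → (f 0).2 ≤ (g j).2 ∧ (g j).2 ≤ (f m).2) :
    ∃ i j, i ≤ m ∧ j ≤ n ∧ f i = g j := by
  by_contra hcon
  push Not at hcon
  have key := wind_grid hf hg hcon
  have hne := fun i j hi hj => ne_zero_pair (hcon i j hi hj)
  have e1 := sum_wind_pot (D := fun i => f i - g 0) (m := m) pot1 (fun i hi =>
    wind_pot1 (adj_sub_right (hf i hi) _) (by have := hfx i (by omega); simp; omega)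
    (by have := hfx (i+1) (by omega); simp; omega) (hne _ _ (by omega) (by omega))
    (hne _ _ (by omega) (by omega)))
  have e2 := sum_wind_pot (D := fun j => f m - g j) (m := n) pot2 (fun i hi =>
    wind_pot2 (adj_sub_left (hg i hi) _) (by have := hgy i (by omega); simp; omega)
    (by have := hgy (i+1) (by omega); simp; omega) (hne _ _ (by omega) (by omega))
    (hne _ _ (by omega) (by omega)))
  have e3 := sum_wind_zero (D := fun j => f 0 - g j) (m := n) (fun i hi =>
    wind_low (by have := hgy i (by omega); simp; omega)
    (by have := hgy (i+1) (by omega); simp; omega))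
  have e4 := sum_wind_zero (D := fun i => f i - g n) (m := m) (fun i hi =>
    wind_neg (by have := hfx i (by omega); simp; omega))
  rw [e1, e2, e3, e4] at key
  have h00 := hgy 0 (by omega)
  have hmn := hne m n (by omega) (by omega)
  have hx1 := hfx m (by omega)
  have hy1 := hgy n (by omega)
  have hy0 := hgy 0 (by omega)
  simp only [pot1, pot2, Prod.fst_sub, Prod.snd_sub] at key hmn
  split_ifs at key <;> omega

/-- enclosure -/
theorem enclose_fun {f g : ℕ → ℤ × ℤ} {m n : ℕ}
    (hf : ∀ i, i < m → Adjacent (f i) (f (i + 1)))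
    (hg : ∀ i, i < n → Adjacent (g i) (g (i + 1)))
    (hfx : ∀ i, i ≤ m → (g 0).1 ≤ (f i).1 ∧ (f i).1 ≤ (g n).1)
    (hgx : ∀ j, j ≤ n → (g j).1 ≤ (g n).1)
    (h0 : (f 0).1 = (g n).1) (hm : (f m).1 = (g n).1)
    (h0' : (f 0).2 ≤ (g n).2) (hm' : (g n).2 ≤ (f m).2) :
    ∃ i j, i ≤ m ∧ j ≤ n ∧ f i = g j := by
  by_contra hcon
  push Not at hcon
  have key := wind_grid hf hg hcon
  have hne := fun i j hi hj => ne_zero_pair (hcon i j hi hj)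
  have e1 := sum_wind_pot (D := fun i => f i - g 0) (m := m) pot1 (fun i hi =>
    wind_pot1 (adj_sub_right (hf i hi) _) (by have := hfx i (by omega); simp; omega)
    (by have := hfx (i+1) (by omega); simp; omega) (hne _ _ (by omega) (by omega))
    (hne _ _ (by omega) (by omega)))
  have e2 := sum_wind_pot (D := fun j => f m - g j) (m := n) pot1 (fun i hi =>
    wind_pot1 (adj_sub_left (hg i hi) _) (by have := hgx i (by omega); simp; omega)
    (by have := hgx (i+1) (by omega); simp; omega) (hne _ _ (by omega) (by omega))
    (hne _ _ (by omega) (by omega)))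
  have e3 := sum_wind_pot (D := fun j => f 0 - g j) (m := n) pot1 (fun i hi =>
    wind_pot1 (adj_sub_left (hg i hi) _) (by have := hgx i (by omega); simp; omega)
    (by have := hgx (i+1) (by omega); simp; omega) (hne _ _ (by omega) (by omega))
    (hne _ _ (by omega) (by omega)))
  have e4 := sum_wind_zero (D := fun i => f i - g n) (m := m) (fun i hi =>
    wind_neg (by have := hfx i (by omega); simp; omega))
  rw [e1, e2, e3, e4] at key
  have hmn := hne m n (by omega) (by omega)
  have h0n := hne 0 n (by omega) (by omega)
  simp only [pot1, Prod.fst_sub, Prod.snd_sub] at key hmn h0n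
  split_ifs at key <;> omega

theorem Conn.cross {ω : Config} {S T : Set (ℤ × ℤ)} {a a' b b' : ℤ × ℤ}
    (hA : Conn ω S a a') (hB : Conn ω T b b')
    (hS : ∀ z ∈ S, b.1 ≤ z.1 ∧ z.1 ≤ b'.1) (hT : ∀ z ∈ T, a.2 ≤ z.2 ∧ z.2 ≤ a'.2) :
    ∃ z, Conn ω S a z ∧ Conn ω T b z := by
  obtain ⟨m, f, f0, fm, f1, f2⟩ := hA.path
  obtain ⟨n, g, g0, gn, g1, g2⟩ := hB.path
  subst f0 fm g0 gn
  obtain ⟨i, j, hi, hj, h⟩ := cross_fun f2 g2 (fun i hi => hS _ (f1 i hi).right.1)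
    (fun i hi => hT _ (g1 i hi).right.1)
  exact ⟨f i, f1 i hi, h ▸ g1 j hj⟩

theorem Conn.enclose {ω : Config} {S T : Set (ℤ × ℤ)} {a a' b b' : ℤ × ℤ}
    (hA : Conn ω S a a') (hB : Conn ω T b b')
    (hS : ∀ z ∈ S, b.1 ≤ z.1 ∧ z.1 ≤ b'.1) (hT : ∀ z ∈ T, z.1 ≤ b'.1)
    (h0 : a.1 = b'.1) (hm : a'.1 = b'.1) (h0' : a.2 ≤ b'.2) (hm' : b'.2 ≤ a'.2) :
    ∃ z, Conn ω S a z ∧ Conn ω T b z := by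
  obtain ⟨m, f, f0, fm, f1, f2⟩ := hA.path
  obtain ⟨n, g, g0, gn, g1, g2⟩ := hB.path
  subst f0 fm g0 gn
  obtain ⟨i, j, hi, hj, h⟩ := enclose_fun f2 g2 (fun i hi => hS _ (f1 i hi).right.1)
    (fun i hi => hT _ (g1 i hi).right.1) h0 hm h0' hm'
  exact ⟨f i, f1 i hi, h ▸ g1 j hj⟩

end Perc

namespace Perc

/-- `A` only depends on the sites of `F`. -/
def Dep (F : Set (ℤ × ℤ)) (A : Set Config) : Prop :=
  ∀ ω ω' : Config, (∀ v ∈ F, ω v = ω' v) → (ω ∈ A ↔ ω' ∈ A)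

theorem Dep.mono {F G : Set (ℤ × ℤ)} {A : Set Config} (h : Dep F A) (hFG : F ⊆ G) : Dep G A :=
  fun ω ω' hω => h ω ω' (fun v hv => hω v (hFG hv))

theorem Dep.inter {F : Set (ℤ × ℤ)} {A B : Set Config} (h : Dep F A) (h' : Dep F B) :
    Dep F (A ∩ B) := fun ω ω' hω => and_congr (h ω ω' hω) (h' ω ω' hω)

theorem Dep.compl {F : Set (ℤ × ℤ)} {A : Set Config} (h : Dep F A) :
    Dep F Aᶜ := fun ω ω' hω => not_congr (h ω ω' hω)

/-- extension of a configuration by `false` -/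
noncomputable def extF (F : Finset (ℤ × ℤ)) (η : F → Bool) : Config :=
  fun v => if h : v ∈ F then η ⟨v, h⟩ else false

/-- restriction of a configuration -/
def resF (F : Finset (ℤ × ℤ)) (ω : Config) : F → Bool := fun v => ω v

theorem measurable_resF (F : Finset (ℤ × ℤ)) : Measurable (resF F) := by
  unfold resF; fun_prop

theorem Dep.eq_preimage {F : Finset (ℤ × ℤ)} {A : Set Config} (h : Dep F A) :
    A = resF F ⁻¹' {η | extF F η ∈ A} := by
  ext ω
  refine h _ _ ?_
  intro v hv
  simp only [extF, resF]
  rw [dif_pos (by exact_mod_cast hv)]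

theorem Dep.meas {F : Set (ℤ × ℤ)} (hF : F.Finite) {A : Set Config} (h : Dep F A) :
    MeasurableSet A := by
  lift F to Finset (ℤ × ℤ) using hF
  rw [h.eq_preimage]
  exact measurable_resF F (Set.toFinite _).measurableSet

theorem resF_preimage (F : Finset (ℤ × ℤ)) (η : F → Bool) :
    resF F ⁻¹' {η} = {ω | ∀ v ∈ F, ω v = extF F η v} := by
  ext ω
  simp only [Set.mem_preimage, Set.mem_singleton_iff, Set.mem_ofPred_eq, funext_iff, resF, extF]
  constructor
  · intro h v hv; rw [dif_pos hv]; exact h ⟨v, hv⟩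
  · intro h v; rw [h v v.2, dif_pos v.2]

open Classical in
theorem Dep.sum {F : Finset (ℤ × ℤ)} {A : Set Config} (h : Dep F A) (μ : Measure Config)
    [IsProbabilityMeasure μ] (B : Set Config) (hB : MeasurableSet B) :
    μ.real (A ∩ B) = ∑ η : F → Bool, (if extF F η ∈ A then 1 else 0) *
      μ.real ({ω | ∀ v ∈ F, ω v = extF F η v} ∩ B) := by
  have h1 := sum_measureReal_preimage_singleton (μ := μ.restrict B)
    (Finset.univ.filter (fun η => extF F η ∈ A)) (f := resF F)
    (fun y _ => measurable_resF F (Set.toFinite _).measurableSet)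
  have h2 : resF F ⁻¹' (↑(Finset.univ.filter (fun η => extF F η ∈ A)) : Set (F → Bool)) = A := by
    conv_rhs => rw [h.eq_preimage]
    congr 1; ext; simp
  rw [h2, measureReal_restrict_apply (h.meas F.finite_toSet)] at h1
  rw [← h1, Finset.sum_filter]
  refine Finset.sum_congr rfl (fun η _ => ?_)
  split_ifs
  · rw [measureReal_restrict_apply (measurable_resF F (Set.toFinite _).measurableSet),
      resF_preimage, one_mul]
  · simp

/-- weight of a site -/
noncomputable def wt (p : ℝ) (b : Bool) : ℝ := if b then p else 1 - p


theorem cyl_real {p : ℝ} (hp0 : 0 ≤ p) (hp1 : p ≤ 1) {μ : Measure Config}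
    (hμ : IsBernoulliProduct p μ) (F : Finset (ℤ × ℤ)) (f : Config) :
    μ.real {ω | ∀ v ∈ F, ω v = f v} = ∏ v ∈ F, wt p (f v) := by
  rw [measureReal_def, hμ.2, ENNReal.toReal_prod]
  refine Finset.prod_congr rfl (fun v _ => ?_)
  unfold wt
  rw [ENNReal.toReal_ofReal]
  split_ifs <;> linarith

theorem wt_nonneg {p : ℝ} (hp0 : 0 ≤ p) (hp1 : p ≤ 1) {μ : Measure Config}
    (_hμ : IsBernoulliProduct p μ) (b : Bool) : 0 ≤ wt p b := by
  unfold wt; split_ifs <;> linarith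

open Classical in
theorem Dep.sum' {p : ℝ} (hp0 : 0 ≤ p) (hp1 : p ≤ 1) {μ : Measure Config}
    (hμ : IsBernoulliProduct p μ) {F : Finset (ℤ × ℤ)} {A : Set Config} (h : Dep F A) :
    μ.real A = ∑ η : F → Bool, (∏ v ∈ F, wt p (extF F η v)) * (if extF F η ∈ A then 1 else 0) := by
  have := hμ.1
  have := h.sum μ Set.univ MeasurableSet.univ
  simp only [Set.inter_univ] at this
  rw [this]
  refine Finset.sum_congr rfl (fun η _ => ?_)
  rw [cyl_real hp0 hp1 hμ, mul_comm]

open Classical in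
theorem harris {p : ℝ} (hp0 : 0 ≤ p) (hp1 : p ≤ 1) {μ : Measure Config}
    (hμ : IsBernoulliProduct p μ) {F : Set (ℤ × ℤ)} (hF : F.Finite) {A B : Set Config} (hA : Dep F A) (hB : Dep F B)
    (uA : IsUpperSet A) (uB : IsUpperSet B) : μ.real A * μ.real B ≤ μ.real (A ∩ B) := by
  have := hμ.1
  lift F to Finset (ℤ × ℤ) using hF
  have hmono : Monotone (extF F) := by
    intro η η' h v
    unfold extF
    split_ifs
    · exact h _
    · exact le_rfl
  have key := fkg (α := F → Bool) (μ := fun η => ∏ v ∈ F, wt p (extF F η v))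
    (f := fun η => if extF F η ∈ A then (1 : ℝ) else 0)
    (g := fun η => if extF F η ∈ B then (1 : ℝ) else 0)
    (fun η => Finset.prod_nonneg (fun v _ => wt_nonneg hp0 hp1 hμ _))
    (fun η => by simp only [Pi.zero_apply]; split_ifs <;> norm_num)
    (fun η => by simp only [Pi.zero_apply]; split_ifs <;> norm_num)
    (fun η η' h => by
      by_cases h1 : extF F η ∈ A
      · simp [h1, uA (hmono h) h1]
      · simp only [h1, if_false]; split_ifs <;> norm_num)
    (fun η η' h => by
      by_cases h1 : extF F η ∈ B
      · simp [h1, uB (hmono h) h1]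
      · simp only [h1, if_false]; split_ifs <;> norm_num)
    (fun a b => by
      rw [← Finset.prod_mul_distrib, ← Finset.prod_mul_distrib]
      refine le_of_eq (Finset.prod_congr rfl (fun v hv => ?_))
      simp only [extF, hv, dif_pos, Pi.inf_apply, Pi.sup_apply]
      cases a ⟨v, hv⟩ <;> cases b ⟨v, hv⟩ <;> simp [mul_comm])
  have h1 : (∑ η : F → Bool, ∏ v ∈ F, wt p (extF F η v)) = 1 := by
    have := Dep.sum' hp0 hp1 hμ (F := F) (A := Set.univ) (fun _ _ _ => by simp)
    simpa using this.symm
  rw [Dep.sum' hp0 hp1 hμ hA, Dep.sum' hp0 hp1 hμ hB, Dep.sum' hp0 hp1 hμ (hA.inter hB)]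
  rw [h1, one_mul] at key
  refine key.trans (le_of_eq (Finset.sum_congr rfl (fun η _ => ?_)))
  by_cases h2 : extF F η ∈ A <;> by_cases h3 : extF F η ∈ B <;> simp [h2, h3]

theorem harris_compl {p : ℝ} (hp0 : 0 ≤ p) (hp1 : p ≤ 1) {μ : Measure Config}
    (hμ : IsBernoulliProduct p μ) {F : Set (ℤ × ℤ)} (hF : F.Finite) {A B : Set Config} (hA : Dep F A)
    (hB : Dep F B) (uA : IsUpperSet A) (uB : IsUpperSet B) :
    (1 - μ.real A) * (1 - μ.real B) ≤ 1 - μ.real (A ∪ B) := by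
  have := hμ.1
  have h := harris hp0 hp1 hμ hF hA hB uA uB
  have h2 := measureReal_union_add_inter (μ := μ) (s := A) (t := B) (hB.meas hF)
  nlinarith

theorem indep {p : ℝ} (hp0 : 0 ≤ p) (hp1 : p ≤ 1) {μ : Measure Config}
    (hμ : IsBernoulliProduct p μ) {F G : Set (ℤ × ℤ)} (hF : F.Finite) (hG : G.Finite) (hFG : Disjoint F G)
    {A B : Set Config} (hA : Dep F A) (hB : Dep G B) :
    μ.real (A ∩ B) = μ.real A * μ.real B := by
  classical
  have := hμ.1
  have mB := hB.meas hG
  lift F to Finset (ℤ × ℤ) using hF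
  lift G to Finset (ℤ × ℤ) using hG
  rw [hA.sum μ B mB, Dep.sum' hp0 hp1 hμ hA, Finset.sum_mul]
  refine Finset.sum_congr rfl (fun η _ => ?_)
  rw [mul_comm (∏ v ∈ F, _), mul_assoc]
  congr 1
  have mC : MeasurableSet {ω : Config | ∀ v ∈ F, ω v = extF F η v} := by
    rw [← resF_preimage]; exact measurable_resF F (Set.toFinite _).measurableSet
  rw [Set.inter_comm, hB.sum μ _ mC, Dep.sum' hp0 hp1 hμ hB, Finset.mul_sum]
  refine Finset.sum_congr rfl (fun ξ _ => ?_)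
  rw [← mul_assoc, mul_comm _ (ite _ _ _)]
  congr 1
  have hd : Disjoint F G := by exact_mod_cast hFG
  have : {ω : Config | ∀ v ∈ G, ω v = extF G ξ v} ∩ {ω | ∀ v ∈ F, ω v = extF F η v} =
      {ω | ∀ v ∈ F ∪ G, ω v = if v ∈ F then extF F η v else extF G ξ v} := by
    ext ω
    simp only [Set.mem_inter_iff, Set.mem_ofPred_eq, Finset.mem_union]
    constructor
    · rintro ⟨h1, h2⟩ v hv
      by_cases h : v ∈ F
      · simp [h, h2 v h]
      · simp [h, h1 v (hv.resolve_left h)]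
    · intro h
      refine ⟨fun v hv => ?_, fun v hv => ?_⟩
      · have := h v (Or.inr hv)
        rwa [if_neg (Finset.disjoint_right.1 hd hv)] at this
      · have := h v (Or.inl hv)
        rwa [if_pos hv] at this
  rw [this, cyl_real hp0 hp1 hμ, Finset.prod_union hd]
  congr 1
  · exact Finset.prod_congr rfl (fun v hv => by rw [if_pos hv])
  · exact Finset.prod_congr rfl (fun v hv => by rw [if_neg (Finset.disjoint_right.1 hd hv)])


theorem bern_unique {p : ℝ} (hp0 : 0 ≤ p) (hp1 : p ≤ 1) {μ ν : Measure Config}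
    (hμ : IsBernoulliProduct p μ) (hν : IsBernoulliProduct p ν) : μ = ν := by
  have := hμ.1
  have := hν.1
  refine ext_of_generate_finite (measurableCylinders (fun _ : ℤ × ℤ => Bool))
    (generateFrom_measurableCylinders (α := fun _ : ℤ × ℤ => Bool)).symm
    isPiSystem_measurableCylinders ?_ (by simp)
  intro A hA
  rw [mem_measurableCylinders] at hA
  obtain ⟨F, S, _, rfl⟩ := hA
  have hd : Dep F (cylinder F S) := by
    intro ω ω' h
    simp only [mem_cylinder]
    have : (F.restrict ω : _) = F.restrict ω' := by
      ext v; simp [h v v.2]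
    rw [this]
  have h1 := Dep.sum' hp0 hp1 hμ hd
  have h2 := Dep.sum' hp0 hp1 hν hd
  rw [← h2] at h1
  exact (ENNReal.toReal_eq_toReal_iff' (measure_ne_top _ _) (measure_ne_top _ _)).1 h1

theorem bern_inv {p : ℝ} (hp0 : 0 ≤ p) (hp1 : p ≤ 1) {μ : Measure Config}
    (hμ : IsBernoulliProduct p μ) (e : ℤ × ℤ ≃ ℤ × ℤ) {A : Set Config} (hA : MeasurableSet A) :
    μ.real ((fun ω : Config => ω ∘ e) ⁻¹' A) = μ.real A := by
  have := hμ.1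
  have hm : Measurable (fun ω : Config => ω ∘ e) := by
    refine measurable_pi_lambda _ (fun v => ?_)
    simp only [Function.comp]
    fun_prop
  have : μ.map (fun ω : Config => ω ∘ e) = μ := by
    refine bern_unique hp0 hp1 ⟨Measure.isProbabilityMeasure_map hm.aemeasurable, ?_⟩ hμ
    intro s f
    have ms : MeasurableSet {ω : Config | ∀ v ∈ s, ω v = f v} :=
      Dep.meas (F := s) s.finite_toSet (fun ω ω' h => by
        simp only [Set.mem_ofPred_eq]
        exact forall₂_congr (fun v hv => by rw [h v hv]))
    rw [Measure.map_apply hm ms]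
    have : (fun ω : Config => ω ∘ e) ⁻¹' {ω | ∀ v ∈ s, ω v = f v} =
        {ω | ∀ v ∈ s.map e.toEmbedding, ω v = (f ∘ e.symm) v} := by
      ext ω
      constructor
      · intro h v hv
        obtain ⟨w, hw, rfl⟩ := Finset.mem_map.1 hv
        have := h w hw
        simpa using this
      · intro h v hv
        have := h (e v) (Finset.mem_map_of_mem _ hv)
        simpa using this
    rw [this, hμ.2, Finset.prod_map]
    simp
  conv_rhs => rw [← this]
  rw [measureReal_def, measureReal_def, Measure.map_apply hm hA]

/-! ### Events -/

/-- there is an open path in `S` from `A` to `B` -/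
def JE (S A B : Set (ℤ × ℤ)) : Set Config := {ω | ∃ a ∈ A, ∃ b ∈ B, Conn ω S a b}

theorem JE_dep (S A B : Set (ℤ × ℤ)) : Dep S (JE S A B) := by
  have : ∀ ω ω' : Config, (∀ v ∈ S, ω v = ω' v) → ω ∈ JE S A B → ω' ∈ JE S A B := by
    rintro ω ω' h ⟨a, ha, b, hb, hc⟩
    exact ⟨a, ha, b, hb, hc.mono le_rfl (fun z hz hz' => by rw [← h z hz]; exact hz')⟩
  exact fun ω ω' h => ⟨this ω ω' h, this ω' ω (fun v hv => (h v hv).symm)⟩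

theorem JE_upper (S A B : Set (ℤ × ℤ)) : IsUpperSet (JE S A B) := by
  rintro ω ω' h ⟨a, ha, b, hb, hc⟩
  refine ⟨a, ha, b, hb, hc.mono le_rfl (fun z _ hz' => ?_)⟩
  have := h z
  rw [hz'] at this
  exact Bool.eq_true_of_true_le this

theorem JE_mono {S S' A A' B B' : Set (ℤ × ℤ)} (h1 : S ⊆ S') (h2 : A ⊆ A') (h3 : B ⊆ B') :
    JE S A B ⊆ JE S' A' B' := by
  rintro ω ⟨a, ha, b, hb, hc⟩
  exact ⟨a, h2 ha, b, h3 hb, hc.mono h1 (fun _ _ h => h)⟩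

theorem JE_union (S A B B' : Set (ℤ × ℤ)) : JE S A (B ∪ B') = JE S A B ∪ JE S A B' := by
  ext ω
  constructor
  · rintro ⟨a, ha, b, hb | hb, hc⟩
    · exact Or.inl ⟨a, ha, b, hb, hc⟩
    · exact Or.inr ⟨a, ha, b, hb, hc⟩
  · rintro (⟨a, ha, b, hb, hc⟩ | ⟨a, ha, b, hb, hc⟩)
    · exact ⟨a, ha, b, Or.inl hb, hc⟩
    · exact ⟨a, ha, b, Or.inr hb, hc⟩

/-- all sites of `F` are open -/
def AO (F : Set (ℤ × ℤ)) : Set Config := {ω | ∀ v ∈ F, ω v = true}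

theorem AO_dep (F : Set (ℤ × ℤ)) : Dep F (AO F) := fun ω ω' h => by
  simp only [AO, Set.mem_ofPred_eq]
  exact forall₂_congr (fun v hv => by rw [h v hv])

theorem AO_upper (F : Set (ℤ × ℤ)) : IsUpperSet (AO F) := by
  intro ω ω' h hω v hv
  have := h v
  rw [hω v hv] at this
  exact Bool.eq_true_of_true_le this

theorem AO_real {p : ℝ} (hp0 : 0 ≤ p) (hp1 : p ≤ 1) {μ : Measure Config}
    (hμ : IsBernoulliProduct p μ) (F : Finset (ℤ × ℤ)) : μ.real (AO F) = p ^ F.card := by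
  have := cyl_real hp0 hp1 hμ F (fun _ => true)
  simp only [wt, if_true, Finset.prod_const] at this
  exact this

theorem rect_finite (a b c d : ℤ) : (rect a b c d).Finite := by
  refine ((Set.finite_Icc a b).prod (Set.finite_Icc c d)).subset ?_
  rintro ⟨x, y⟩ h
  rw [mem_rect] at h
  simp only [Set.mem_prod, Set.mem_Icc]
  omega

theorem Conn.map {ω : Config} {S S' : Set (ℤ × ℤ)} {a b : ℤ × ℤ} (e : ℤ × ℤ → ℤ × ℤ)
    (he : ∀ a b, Adjacent a b → Adjacent (e a) (e b)) (hS : ∀ v ∈ S, e v ∈ S')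
    (h : Conn (ω ∘ e) S a b) : Conn ω S' (e a) (e b) := by
  refine h.induct (fun b => Conn ω S' (e a) (e b)) (Conn.refl (hS _ h.1) h.2.1) ?_
  intro b c _ hbc hc hc' ih
  exact ih.tail (he _ _ hbc) (hS _ hc) hc'

theorem JE_inv {p : ℝ} (hp0 : 0 ≤ p) (hp1 : p ≤ 1) {μ : Measure Config}
    (hμ : IsBernoulliProduct p μ) (e : ℤ × ℤ ≃ ℤ × ℤ)
    (he : ∀ a b, Adjacent a b → Adjacent (e a) (e b))
    (he' : ∀ a b, Adjacent a b → Adjacent (e.symm a) (e.symm b))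
    {S A B S' A' B' : Set (ℤ × ℤ)} (hfin : S.Finite) (hS : ∀ v, e v ∈ S' ↔ v ∈ S)
    (hA : ∀ v, e v ∈ A' ↔ v ∈ A) (hB : ∀ v, e v ∈ B' ↔ v ∈ B) :
    μ.real (JE S' A' B') = μ.real (JE S A B) := by
  rw [← bern_inv hp0 hp1 hμ e ((JE_dep S A B).meas hfin)]
  congr 1
  ext ω
  constructor
  · rintro ⟨a, ha, b, hb, hc⟩
    refine ⟨e.symm a, by rw [← hA]; simpa using ha, e.symm b, by rw [← hB]; simpa using hb, ?_⟩
    refine Conn.map (S := S') e.symm he' (fun v hv => by rw [← hS]; simpa using hv) ?_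
    have : (ω ∘ e) ∘ e.symm = ω := by ext v; simp
    simpa [this] using hc
  · rintro ⟨a, ha, b, hb, hc⟩
    exact ⟨e a, (hA a).2 ha, e b, (hB b).2 hb, Conn.map e he (fun v hv => (hS v).2 hv) hc⟩

/-- symmetries -/
def tr (t : ℤ × ℤ) : ℤ × ℤ ≃ ℤ × ℤ := Equiv.addRight t
def flipx : ℤ × ℤ ≃ ℤ × ℤ where
  toFun v := (-v.1, v.2)
  invFun v := (-v.1, v.2)
  left_inv v := by simp
  right_inv v := by simp
def flipy : ℤ × ℤ ≃ ℤ × ℤ where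
  toFun v := (v.1, -v.2)
  invFun v := (v.1, -v.2)
  left_inv v := by simp
  right_inv v := by simp
def swap : ℤ × ℤ ≃ ℤ × ℤ := Equiv.prodComm ℤ ℤ

theorem adj_of {a b : ℤ × ℤ} (h : (b.1 = a.1 + 1 ∧ b.2 = a.2) ∨ (b.1 = a.1 - 1 ∧ b.2 = a.2) ∨
    (b.1 = a.1 ∧ b.2 = a.2 + 1) ∨ (b.1 = a.1 ∧ b.2 = a.2 - 1)) : Adjacent a b := by
  unfold Adjacent
  rcases abs_cases (a.1 - b.1) with h1 | h1 <;> rcases abs_cases (a.2 - b.2) with h2 | h2 <;> omega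


theorem JE_tr {p : ℝ} (hp0 : 0 ≤ p) (hp1 : p ≤ 1) {μ : Measure Config}
    (hμ : IsBernoulliProduct p μ) (t : ℤ × ℤ) {S A B S' A' B' : Set (ℤ × ℤ)} (hfin : S.Finite)
    (hS : ∀ v, v + t ∈ S' ↔ v ∈ S)
    (hA : ∀ v, v + t ∈ A' ↔ v ∈ A) (hB : ∀ v, v + t ∈ B' ↔ v ∈ B) :
    μ.real (JE S' A' B') = μ.real (JE S A B) :=
  JE_inv hp0 hp1 hμ (tr t)
    (fun a b h => by unfold Adjacent at *; simpa [tr] using h)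
    (fun a b h => by unfold Adjacent at *; simpa [tr] using h) hfin hS hA hB

theorem JE_flipx {p : ℝ} (hp0 : 0 ≤ p) (hp1 : p ≤ 1) {μ : Measure Config}
    (hμ : IsBernoulliProduct p μ) {S A B S' A' B' : Set (ℤ × ℤ)} (hfin : S.Finite)
    (hS : ∀ v : ℤ × ℤ, (-v.1, v.2) ∈ S' ↔ v ∈ S)
    (hA : ∀ v : ℤ × ℤ, (-v.1, v.2) ∈ A' ↔ v ∈ A) (hB : ∀ v : ℤ × ℤ, (-v.1, v.2) ∈ B' ↔ v ∈ B) :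
    μ.real (JE S' A' B') = μ.real (JE S A B) :=
  JE_inv hp0 hp1 hμ flipx
    (fun a b h => adj_of (by have := adj_cases h; simp [flipx]; omega))
    (fun a b h => adj_of (by have := adj_cases h; simp [flipx]; omega)) hfin hS hA hB

theorem JE_flipy {p : ℝ} (hp0 : 0 ≤ p) (hp1 : p ≤ 1) {μ : Measure Config}
    (hμ : IsBernoulliProduct p μ) {S A B S' A' B' : Set (ℤ × ℤ)} (hfin : S.Finite)
    (hS : ∀ v : ℤ × ℤ, (v.1, -v.2) ∈ S' ↔ v ∈ S)
    (hA : ∀ v : ℤ × ℤ, (v.1, -v.2) ∈ A' ↔ v ∈ A) (hB : ∀ v : ℤ × ℤ, (v.1, -v.2) ∈ B' ↔ v ∈ B) :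
    μ.real (JE S' A' B') = μ.real (JE S A B) :=
  JE_inv hp0 hp1 hμ flipy
    (fun a b h => adj_of (by have := adj_cases h; simp [flipy]; omega))
    (fun a b h => adj_of (by have := adj_cases h; simp [flipy]; omega)) hfin hS hA hB

theorem JE_swap {p : ℝ} (hp0 : 0 ≤ p) (hp1 : p ≤ 1) {μ : Measure Config}
    (hμ : IsBernoulliProduct p μ) {S A B S' A' B' : Set (ℤ × ℤ)} (hfin : S.Finite)
    (hS : ∀ v : ℤ × ℤ, (v.2, v.1) ∈ S' ↔ v ∈ S)
    (hA : ∀ v : ℤ × ℤ, (v.2, v.1) ∈ A' ↔ v ∈ A) (hB : ∀ v : ℤ × ℤ, (v.2, v.1) ∈ B' ↔ v ∈ B) :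
    μ.real (JE S' A' B') = μ.real (JE S A B) :=
  JE_inv hp0 hp1 hμ swap
    (fun a b h => adj_of (by have := adj_cases h; simp [swap]; omega))
    (fun a b h => adj_of (by have := adj_cases h; simp [swap]; omega)) hfin hS hA hB

end Perc

namespace Perc

/-- box of radius `r` around `c` -/
def bx (c : ℤ × ℤ) (r : ℤ) : Set (ℤ × ℤ) := rect (c.1 - r) (c.1 + r) (c.2 - r) (c.2 + r)

theorem mem_bx {c v : ℤ × ℤ} {r : ℤ} : v ∈ bx c r ↔
    c.1 - r ≤ v.1 ∧ v.1 ≤ c.1 + r ∧ c.2 - r ≤ v.2 ∧ v.2 ≤ c.2 + r := mem_rect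

theorem bx_finite (c : ℤ × ℤ) (r : ℤ) : (bx c r).Finite := rect_finite _ _ _ _

theorem sn_cases (v : ℤ × ℤ) : (sn v = v.1 ∨ sn v = -v.1 ∨ sn v = v.2 ∨ sn v = -v.2) ∧
    v.1 ≤ sn v ∧ - v.1 ≤ sn v ∧ v.2 ≤ sn v ∧ -v.2 ≤ sn v := by
  unfold sn
  rcases abs_cases v.1 with h | h <;> rcases abs_cases v.2 with h' | h' <;>
    rcases max_cases |v.1| |v.2| with h3 | h3 <;> omega

/-- arm event -/
def arm (c : ℤ × ℤ) (r : ℤ) : Set Config := JE (bx c r) {c} {v | sn (v - c) = r}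

theorem arm_dep (c : ℤ × ℤ) (r : ℤ) : Dep (bx c r) (arm c r) := JE_dep _ _ _

theorem cut_sn {ω : Config} {S : Set (ℤ × ℤ)} {c v w : ℤ × ℤ} {l r : ℤ} (h : Conn ω S v w)
    (hlr : l ≤ r) (h1 : sn (v - c) ≤ l) (h2 : r ≤ sn (w - c)) :
    ∃ a b, sn (a - c) = l ∧ sn (b - c) = r ∧ Conn ω (bx c r) a b := by
  obtain ⟨a, b, ha, hb, hc⟩ := h.cut (fun z => sn (z - c))
    (fun a b hab => lip_sn _ _ (by unfold Adjacent at *; simpa using hab)) hlr h1 h2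
  refine ⟨a, b, ha, hb, hc.mono ?_ (fun _ _ h => h)⟩
  rintro z ⟨_, _, hz⟩
  have := sn_cases (z - c)
  rw [mem_bx]
  simp only [Prod.fst_sub, Prod.snd_sub] at this
  omega

theorem sn_self (c : ℤ × ℤ) : sn (c - c) = 0 := by simp [sn]

theorem sn_eq_zero {v c : ℤ × ℤ} (h : sn (v - c) = 0) : v = c := by
  have := sn_cases (v - c)
  simp only [Prod.fst_sub, Prod.snd_sub] at this
  ext <;> omega

theorem arm_anti (c : ℤ × ℤ) {r s : ℤ} (h0 : 0 ≤ r) (h : r ≤ s) : arm c s ⊆ arm c r := by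
  rintro ω ⟨a, rfl, b, hb, hc⟩
  simp only [Set.mem_ofPred_eq] at hb
  obtain ⟨a', b', ha', hb', hc'⟩ := cut_sn (c := a) hc h0 (sn_self a).le (by omega)
  obtain rfl := sn_eq_zero ha'
  exact ⟨a', rfl, b', hb', hc'⟩

theorem inf_arm (r : ℤ) (h0 : 0 ≤ r) :
    {ω : Config | (cluster ω Set.univ (0, 0)).Infinite} ⊆ arm 0 r := by
  intro ω hω
  obtain ⟨w, hw, hw'⟩ := hω.exists_notMem_finite (bx_finite 0 r)
  have hc : Conn ω Set.univ 0 w := hw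
  have h1 : r ≤ sn (w - 0) := by
    have := sn_cases (w - 0)
    rw [mem_bx] at hw'
    simp at this hw' ⊢
    omega
  obtain ⟨a', b', ha', hb', hc'⟩ := cut_sn (c := 0) hc h0 (sn_self 0).le h1
  obtain rfl := sn_eq_zero ha'
  exact ⟨0, rfl, b', hb', hc'⟩

theorem pc_nonneg : 0 ≤ siteCriticalProbability :=
  Real.sSup_nonneg (fun _ h => h.1.1)

theorem theta_pos {p : ℝ} (hpc : siteCriticalProbability < p)
    (hp1 : p ≤ 1) {μ : Measure Config} (hμ : IsBernoulliProduct p μ) :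
    ∃ θ : ℝ, 0 < θ ∧ ∀ r : ℕ, θ ≤ μ.real (arm 0 r) := by
  have := hμ.1
  have hp0 := pc_nonneg.trans hpc.le
  have hn : p ∉ {p : ℝ | p ∈ Set.Icc (0 : ℝ) 1 ∧
    ∀ μ : Measure Config, IsBernoulliProduct p μ →
      μ {ω | (cluster ω Set.univ (0, 0)).Infinite} = 0} := by
    intro h
    have := le_csSup (⟨1, fun _ h => h.1.2⟩) h
    exact absurd hpc (not_lt.2 this)
  have h1 : μ {ω | (cluster ω Set.univ (0, 0)).Infinite} ≠ 0 := by
    intro h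
    refine hn ⟨⟨hp0, hp1⟩, fun ν hν => ?_⟩
    rw [bern_unique hp0 hp1 hν hμ, h]
  refine ⟨μ.real {ω | (cluster ω Set.univ (0, 0)).Infinite}, ?_, fun r => ?_⟩
  · exact ENNReal.toReal_pos h1 (measure_ne_top _ _)
  · exact measureReal_mono (inf_arm r (by positivity))


theorem arm_tr {p : ℝ} (hp0 : 0 ≤ p) (hp1 : p ≤ 1) {μ : Measure Config}
    (hμ : IsBernoulliProduct p μ) (c : ℤ × ℤ) (r : ℤ) : μ.real (arm c r) = μ.real (arm 0 r) := by
  refine JE_tr hp0 hp1 hμ c (bx_finite _ _) (fun v => ?_) (fun v => ?_) (fun v => ?_)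
  · simp only [mem_bx]; simp; omega
  · simp
  · simp

theorem no_arms {p : ℝ} (hp0 : 0 ≤ p) (hp1 : p ≤ 1) {μ : Measure Config}
    (hμ : IsBernoulliProduct p μ) (r : ℕ) (j : ℕ) :
    Dep (rect (-r) (j * (2 * r + 1) - r - 1) (-r) r)
      {ω | ∀ i < j, ω ∉ arm ((i : ℤ) * (2 * r + 1), 0) r} ∧
    μ.real {ω | ∀ i < j, ω ∉ arm ((i : ℤ) * (2 * r + 1), 0) r} = (1 - μ.real (arm 0 r)) ^ j := by
  have := hμ.1
  induction j with
  | zero =>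
    refine ⟨fun ω ω' _ => by simp, ?_⟩
    simp [Set.ofPred_true]
  | succ j ih =>
    obtain ⟨ih1, ih2⟩ := ih
    have e : {ω | ∀ i < j + 1, ω ∉ arm ((i : ℤ) * (2 * r + 1), 0) r} =
      {ω | ∀ i < j, ω ∉ arm ((i : ℤ) * (2 * r + 1), 0) r} ∩
        (arm ((j : ℤ) * (2 * r + 1), 0) r)ᶜ := by
      ext ω
      simp only [Set.mem_ofPred_eq, Set.mem_inter_iff, Set.mem_compl_iff]
      exact Nat.forall_lt_succ_right
    rw [e]
    refine ⟨?_, ?_⟩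
    · refine Dep.inter (ih1.mono ?_) ((arm_dep _ _).compl.mono ?_)
      · intro v hv
        rw [mem_rect] at hv ⊢
        push_cast
        have : ((j : ℤ) + 1) * (2 * r + 1) = j * (2 * r + 1) + (2 * r + 1) := by ring
        omega
      · intro v hv
        rw [mem_bx] at hv
        rw [mem_rect]
        push_cast
        have : ((j : ℤ) + 1) * (2 * r + 1) = j * (2 * r + 1) + (2 * r + 1) := by ring
        have : (0 : ℤ) ≤ j * (2 * r + 1) := by positivity
        simp only at hv
        omega
    · rw [indep hp0 hp1 hμ (rect_finite _ _ _ _) (bx_finite _ _) ?_ ih1 (arm_dep _ _).compl, ih2,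
        probReal_compl_eq_one_sub ((arm_dep _ _).meas (bx_finite _ _)), arm_tr hp0 hp1 hμ (_ * _, 0), pow_succ]
      rw [Set.disjoint_left]
      intro v hv hv'
      rw [mem_rect] at hv
      rw [mem_bx] at hv'
      simp only at hv'
      omega

theorem seed_exists {p : ℝ} (hp0 : 0 ≤ p) (hp1 : p ≤ 1) {μ : Measure Config}
    (hμ : IsBernoulliProduct p μ) {θ : ℝ} (hθ : 0 < θ) (h : ∀ r : ℕ, θ ≤ μ.real (arm 0 r)) {ε : ℝ}
    (hε : 0 < ε) : ∃ k : ℕ, ∀ M : ℕ, k ≤ M →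
      1 - ε ≤ μ.real (JE (bx 0 M) (bx 0 k) {v | sn (v - 0) = M}) := by
  have := hμ.1
  set I := ⨅ r : ℕ, μ.real (arm 0 r) with hI
  have hb : BddBelow (Set.range (fun r : ℕ => μ.real (arm 0 r))) :=
    ⟨0, by rintro _ ⟨r, rfl⟩; exact measureReal_nonneg⟩
  have hIθ : θ ≤ I := le_ciInf h
  have hIle : ∀ r : ℕ, I ≤ μ.real (arm 0 r) := fun r => ciInf_le hb r
  have hI1 : I ≤ 1 := (hIle 0).trans measureReal_le_one
  obtain ⟨j, hj⟩ := exists_pow_lt_of_lt_one (half_pos hε) (show 1 - I < 1 by linarith)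
  have hj' : (1 - I) ^ (j + 1) < ε / 2 := lt_of_le_of_lt
    (pow_le_pow_of_le_one (by linarith) (by linarith) (Nat.le_succ j)) hj
  set J := j + 1 with hJ
  have hJ0 : (0 : ℝ) < J := by positivity
  obtain ⟨r, hr⟩ := exists_lt_of_ciInf_lt (show I < I + ε / (2 * J) by
    have : 0 < ε / (2 * J) := by positivity
    linarith)
  refine ⟨J * (2 * r + 1), fun M hM => ?_⟩
  have hrM : r ≤ M := by nlinarith
  set Q := JE (bx 0 M) (bx 0 ((J * (2 * r + 1) : ℕ) : ℤ)) {v | sn (v - 0) = M} with hQ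
  have hsub : ∀ i < J, arm ((i : ℤ) * (2 * r + 1), 0) (2 * M) ⊆ Q := by
    rintro i hi ω ⟨a, rfl, b, hb, hc⟩
    simp only [Set.mem_ofPred_eq] at hb
    have h1 : 0 ≤ (i : ℤ) * (2 * r + 1) := by positivity
    have h2 : (i : ℤ) * (2 * r + 1) ≤ (J : ℤ) * (2 * r + 1) := by
      have : (i : ℤ) ≤ J := by exact_mod_cast hi.le
      gcongr
    have h3 : (J : ℤ) * (2 * r + 1) ≤ M := by exact_mod_cast hM
    set x := (i : ℤ) * (2 * r + 1)
    have e1 := sn_cases (((x, 0) : ℤ × ℤ) - 0)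
    have e2 := sn_cases (b - (x, 0))
    have e3 := sn_cases (b - 0)
    simp at e1 e2 e3 hb
    obtain ⟨a', b', ha', hb', hc'⟩ := cut_sn (c := 0) hc (l := x) (r := M) (by omega)
      (by simp; omega) (by simp; omega)
    refine ⟨a', ?_, b', hb', hc'⟩
    have e4 := sn_cases (a' - 0)
    rw [mem_bx]
    push_cast
    simp at e4 ha' ⊢
    omega
  have hcov : Qᶜ ⊆ {ω | ∀ i < J, ω ∉ arm ((i : ℤ) * (2 * r + 1), 0) r} ∪
      ⋃ i ∈ Finset.range J, (arm ((i : ℤ) * (2 * r + 1), 0) r \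
        arm ((i : ℤ) * (2 * r + 1), 0) (2 * M)) := by
    intro ω hω
    by_cases hh : ∀ i < J, ω ∉ arm ((i : ℤ) * (2 * r + 1), 0) r
    · exact Or.inl hh
    · push Not at hh
      obtain ⟨i, hi, hi'⟩ := hh
      refine Or.inr ?_
      simp only [Set.mem_iUnion]
      exact ⟨i, Finset.mem_range.2 hi, hi', fun h => hω (hsub i hi h)⟩
  have h1 : μ.real Qᶜ ≤ (1 - μ.real (arm 0 r)) ^ J + ∑ i ∈ Finset.range J, ε / (2 * J) := by
    refine (measureReal_mono hcov).trans ((measureReal_union_le _ _).trans ?_)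
    rw [(no_arms hp0 hp1 hμ r J).2]
    refine add_le_add_right ((measureReal_biUnion_finset_le _ _).trans ?_) _
    refine Finset.sum_le_sum (fun i _ => ?_)
    rw [measureReal_sdiff (arm_anti _ (by positivity) (by omega))
      ((arm_dep _ _).meas (bx_finite _ _)), arm_tr hp0 hp1 hμ (_, 0) r,
      arm_tr hp0 hp1 hμ (_, 0) (2 * M)]
    have := hIle (2 * M)
    push_cast at this
    linarith
  rw [probReal_compl_eq_one_sub ((JE_dep _ _ _).meas (bx_finite _ _))] at h1
  have h2 : (1 - μ.real (arm 0 r)) ^ J ≤ (1 - I) ^ J :=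
    pow_le_pow_left₀ (by linarith [measureReal_le_one (μ := μ) (s := arm 0 r)])
      (by linarith [hIle r]) _
  rw [Finset.sum_const, Finset.card_range, nsmul_eq_mul] at h1
  have h3 : (J : ℝ) * (ε / (2 * J)) = ε / 2 := by field_simp
  linarith

end Perc

namespace Perc

/-- the seed around `u` is joined to a piece of the right side of the box of radius `M` -/
def RS (u : ℤ × ℤ) (M k a b : ℤ) : Set Config :=
  JE (bx u M) (bx u k) {v | v.1 = u.1 + M ∧ u.2 + a ≤ v.2 ∧ v.2 ≤ u.2 + b}

/-- the seed around `u` is joined to the left side of the box of radius `M` -/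
def LS (u : ℤ × ℤ) (M k : ℤ) : Set Config :=
  JE (bx u M) (bx u k) {v | v.1 = u.1 - M ∧ u.2 - M ≤ v.2 ∧ v.2 ≤ u.2 + M}


theorem RS_tr {p : ℝ} (hp0 : 0 ≤ p) (hp1 : p ≤ 1) {μ : Measure Config}
    (hμ : IsBernoulliProduct p μ) (u : ℤ × ℤ) (M k a b : ℤ) : μ.real (RS u M k a b) = μ.real (RS 0 M k a b) := by
  refine JE_tr hp0 hp1 hμ u (bx_finite _ _) (fun v => ?_) (fun v => ?_) (fun v => ?_)
  · simp only [mem_bx]; simp; omega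
  · simp only [mem_bx]; simp; omega
  · simp only [Set.mem_ofPred_eq]; simp; omega

theorem LS_tr {p : ℝ} (hp0 : 0 ≤ p) (hp1 : p ≤ 1) {μ : Measure Config}
    (hμ : IsBernoulliProduct p μ) (u : ℤ × ℤ) (M k : ℤ) : μ.real (LS u M k) = μ.real (LS 0 M k) := by
  refine JE_tr hp0 hp1 hμ u (bx_finite _ _) (fun v => ?_) (fun v => ?_) (fun v => ?_)
  · simp only [mem_bx]; simp; omega
  · simp only [mem_bx]; simp; omega
  · simp only [Set.mem_ofPred_eq]; simp; omega

theorem RS_flip {p : ℝ} (hp0 : 0 ≤ p) (hp1 : p ≤ 1) {μ : Measure Config}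
    (hμ : IsBernoulliProduct p μ) (M k a b : ℤ) : μ.real (RS 0 M k (-b) (-a)) = μ.real (RS 0 M k a b) := by
  refine JE_flipy hp0 hp1 hμ (bx_finite _ _) (fun v => ?_) (fun v => ?_) (fun v => ?_)
  · simp only [mem_bx]; simp; omega
  · simp only [mem_bx]; simp; omega
  · simp only [Set.mem_ofPred_eq]; simp; omega

theorem LS_flip {p : ℝ} (hp0 : 0 ≤ p) (hp1 : p ≤ 1) {μ : Measure Config}
    (hμ : IsBernoulliProduct p μ) (M k : ℤ) : μ.real (LS 0 M k) = μ.real (RS 0 M k (-M) M) := by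
  refine JE_flipx hp0 hp1 hμ (bx_finite _ _) (fun v => ?_) (fun v => ?_) (fun v => ?_)
  · simp only [mem_bx]; simp; omega
  · simp only [mem_bx]; simp; omega
  · simp only [Set.mem_ofPred_eq]; simp

theorem split_le {p : ℝ} (hp0 : 0 ≤ p) (hp1 : p ≤ 1) {μ : Measure Config}
    (hμ : IsBernoulliProduct p μ) {S A B C D : Set (ℤ × ℤ)} (hS : S.Finite) (h : D ⊆ B ∪ C) :
    (1 - μ.real (JE S A B)) * (1 - μ.real (JE S A C)) ≤ 1 - μ.real (JE S A D) := by
  have := hμ.1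
  have h1 := harris_compl hp0 hp1 hμ hS (JE_dep S A B) (JE_dep S A C) (JE_upper _ _ _)
    (JE_upper _ _ _)
  rw [← JE_union] at h1
  have h2 := measureReal_mono (μ := μ) (JE_mono (le_refl S) (le_refl A) h)
  linarith

theorem octant {p : ℝ} (hp0 : 0 ≤ p) (hp1 : p ≤ 1) {μ : Measure Config}
    (hμ : IsBernoulliProduct p μ) (M k : ℤ) :
    (1 - μ.real (RS 0 M k 0 M)) ^ 8 ≤ 1 - μ.real (JE (bx 0 M) (bx 0 k) {v | sn (v - 0) = M}) := by
  have := hμ.1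
  have h1 : (1 - μ.real (RS 0 M k 0 M)) * (1 - μ.real (RS 0 M k (-M) (-0))) ≤
      1 - μ.real (RS 0 M k (-M) M) := by
    refine split_le hp0 hp1 hμ (bx_finite _ _) ?_
    intro v hv
    simp at hv ⊢
    omega
  rw [RS_flip hp0 hp1 hμ] at h1
  have h2 : (1 - μ.real (RS 0 M k (-M) M)) * (1 - μ.real (LS 0 M k)) ≤
      1 - μ.real (JE (bx 0 M) (bx 0 k) {v | (v.1 = M ∨ v.1 = - M) ∧ - M ≤ v.2 ∧ v.2 ≤ M}) := by
    refine split_le hp0 hp1 hμ (bx_finite _ _) ?_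
    intro v hv
    simp at hv ⊢
    omega
  rw [LS_flip hp0 hp1 hμ] at h2
  have h3 : (1 - μ.real (JE (bx 0 M) (bx 0 k) {v | (v.1 = M ∨ v.1 = - M) ∧ - M ≤ v.2 ∧ v.2 ≤ M})) *
     (1 - μ.real (JE (bx 0 M) (bx 0 k) {v | (v.2 = M ∨ v.2 = - M) ∧ - M ≤ v.1 ∧ v.1 ≤ M})) ≤
      1 - μ.real (JE (bx 0 M) (bx 0 k) {v | sn (v - 0) = M}) := by
    refine split_le hp0 hp1 hμ (bx_finite _ _) ?_
    intro v hv
    have := sn_cases (v - 0)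
    simp at hv this ⊢
    omega
  have h4 : μ.real (JE (bx 0 M) (bx 0 k) {v | (v.2 = M ∨ v.2 = - M) ∧ - M ≤ v.1 ∧ v.1 ≤ M}) =
     μ.real (JE (bx 0 M) (bx 0 k) {v | (v.1 = M ∨ v.1 = - M) ∧ - M ≤ v.2 ∧ v.2 ≤ M}) := by
    refine JE_swap hp0 hp1 hμ (bx_finite _ _) (fun v => ?_) (fun v => ?_) (fun v => ?_)
    · simp only [mem_bx]; simp; omega
    · simp only [mem_bx]; simp; omega
    · simp only [Set.mem_ofPred_eq]
  rw [h4] at h3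
  have e1 : 0 ≤ 1 - μ.real (RS 0 M k 0 M) := by
    linarith [measureReal_le_one (μ := μ) (s := RS 0 M k 0 M)]
  set x := 1 - μ.real (RS 0 M k 0 M)
  set y := 1 - μ.real (RS 0 M k (-M) M)
  set z := 1 - μ.real (JE (bx 0 M) (bx 0 k) {v | (v.1 = M ∨ v.1 = - M) ∧ - M ≤ v.2 ∧ v.2 ≤ M})
  have a1 : x ^ 2 ≤ y := by nlinarith
  have a2 : x ^ 4 ≤ z := by
    calc x ^ 4 = (x ^ 2) ^ 2 := by ring
      _ ≤ y ^ 2 := pow_le_pow_left₀ (by positivity) a1 _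
      _ ≤ z := by nlinarith
  calc x ^ 8 = (x ^ 4) ^ 2 := by ring
    _ ≤ z ^ 2 := pow_le_pow_left₀ (by positivity) a2 _
    _ ≤ _ := by nlinarith

theorem alpha_exists {p : ℝ} (hp0 : 0 ≤ p) (hp1 : p ≤ 1) {μ : Measure Config}
    (hμ : IsBernoulliProduct p μ) {k M : ℕ} {ε : ℝ} (hε : 0 < ε) (hε1 : ε ≤ 1)
    (h : 1 - ε ^ 16 ≤ μ.real (JE (bx 0 M) (bx 0 k) {v | sn (v - 0) = M})) :
    ∃ a : ℕ, a ≤ M ∧ 1 - ε ≤ μ.real (RS 0 M k a M) ∧ 1 - ε ≤ μ.real (RS 0 M k 0 a) := by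
  classical
  have := hμ.1
  have h0 := octant hp0 hp1 hμ M k
  have h1 : 1 - μ.real (RS 0 M k 0 M) ≤ ε ^ 2 := by
    refine le_of_pow_le_pow_left₀ (n := 8) (by norm_num) (by positivity) ?_
    calc _ ≤ _ := h0
      _ ≤ ε ^ 16 := by linarith
      _ = _ := by ring
  have h2 : ε ^ 2 ≤ ε := by nlinarith
  set a := Nat.findGreatest (fun a => 1 - ε ≤ μ.real (RS 0 M k a M)) M with ha
  have haM : a ≤ M := Nat.findGreatest_le _
  refine ⟨a, haM, ?_, ?_⟩
  · have : 1 - ε ≤ μ.real (RS 0 M k (0 : ℕ) M) := by push_cast; linarith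
    exact Nat.findGreatest_spec (P := fun a : ℕ => 1 - ε ≤ μ.real (RS 0 M k a M)) (Nat.zero_le M) this
  · rcases haM.eq_or_lt with e | e
    · rw [e]; linarith
    · have h3 : ¬ 1 - ε ≤ μ.real (RS 0 M k (a + 1 : ℕ) M) :=
        Nat.findGreatest_is_greatest (P := fun a : ℕ => 1 - ε ≤ μ.real (RS 0 M k a M))
          (Nat.lt_succ_self a) e
      have h4 : (1 - μ.real (RS 0 M k 0 a)) * (1 - μ.real (RS 0 M k (a + 1 : ℕ) M)) ≤
          1 - μ.real (RS 0 M k 0 M) := by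
        refine split_le hp0 hp1 hμ (bx_finite _ _) ?_
        intro v hv
        simp at hv ⊢
        omega
      push Not at h3
      have e1 : 0 ≤ 1 - μ.real (RS 0 M k 0 a) := by
        linarith [measureReal_le_one (μ := μ) (s := RS 0 M k 0 a)]
      nlinarith


theorem good_scale (α : ℕ → ℕ) (k N : ℕ) (hα : ∀ M, k ≤ M → α M ≤ M) :
    ∃ M, N ≤ M ∧ α (M + M / 2) ≤ 2 * α M := by
  by_contra! h
  obtain ⟨s, hs0, hs⟩ : ∃ s : ℕ → ℕ, s 0 = N + k ∧ ∀ j, s (j + 1) = s j + s j / 2 :=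
    ⟨fun j => (fun m => m + m / 2)^[j] (N + k), rfl, fun j => by
      beta_reduce; rw [Function.iterate_succ_apply']⟩
  have h1 : ∀ j, N + k ≤ s j := by
    intro j
    induction j with
    | zero => exact hs0.ge
    | succ j ih => rw [hs]; omega
  have h2 : ∀ j, 2 ^ j ≤ α (s j) + 1 := by
    intro j
    induction j with
    | zero => simp
    | succ j ih =>
      have := h (s j) (by have := h1 j; omega)
      rw [hs, pow_succ]; omega
  have h3 : ∀ j : ℕ, ((s j : ℕ) : ℝ) ≤ (3 / 2) ^ j * (N + k) := by
    intro j
    induction j with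
    | zero => simp [hs0]
    | succ j ih =>
      rw [hs, pow_succ]
      push_cast
      have : ((s j / 2 : ℕ) : ℝ) ≤ (s j : ℝ) / 2 := by
        have := @Nat.cast_div_le ℝ _ _ _ (s j) 2
        simpa using this
      linarith
  obtain ⟨j, hj⟩ := pow_unbounded_of_one_lt ((N : ℝ) + k + 1) (show (1 : ℝ) < 4 / 3 by norm_num)
  have h4 : ((2 : ℝ)) ^ j ≤ s j + 1 := by
    have := hα (s j) (by have := h1 j; omega)
    have := h2 j
    exact_mod_cast (by omega : 2 ^ j ≤ s j + 1)
  have h5 : (2 : ℝ) ^ j = (4 / 3) ^ j * (3 / 2) ^ j := by rw [← mul_pow]; norm_num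
  have h6 : (1 : ℝ) ≤ (3 / 2) ^ j := one_le_pow₀ (by norm_num)
  have := h3 j
  nlinarith

end Perc

namespace Perc

theorem second_moment {Ω : Type*} [MeasurableSpace Ω] (μ : Measure Ω) [IsProbabilityMeasure μ]
    (T : ℕ) (S : ℕ → Set Ω) (hS : ∀ t, MeasurableSet (S t)) (B : Set Ω) (hB : MeasurableSet B)
    (hind : ∀ t s, t ≠ s → μ.real (S t ∩ S s) ≤ μ.real (S t) * μ.real (S s))
    (δ : ℝ) (hδ : ∀ t < T, μ.real (B ∩ S t) ≤ δ * μ.real (S t))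
    (m : ℝ) (hm : m = ∑ t ∈ Finset.range T, μ.real (S t)) (hm0 : 0 < m) :
    μ.real B ≤ 2 * δ + 1 / m := by
  have ind : ∀ A : Set Ω, MeasurableSet A → Integrable (A.indicator (fun _ => (1 : ℝ))) μ :=
    fun A hA => (integrable_const 1).indicator hA
  have int : ∀ A : Set Ω, MeasurableSet A → ∫ ω, A.indicator (fun _ => (1 : ℝ)) ω ∂μ = μ.real A :=
    fun A hA => by rw [integral_indicator_const _ hA]; simp
  have hle : ∫ ω, m ^ 2 * B.indicator (fun _ => (1 : ℝ)) ω ∂μ ≤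
      ∫ ω, (2 * m * (∑ t ∈ Finset.range T, (B ∩ S t).indicator (fun _ => (1 : ℝ)) ω) + m ^ 2
        - 2 * m * (∑ t ∈ Finset.range T, (S t).indicator (fun _ => (1 : ℝ)) ω)
        + ∑ t ∈ Finset.range T, ∑ s ∈ Finset.range T,
          (S t ∩ S s).indicator (fun _ => (1 : ℝ)) ω) ∂μ := by
    refine integral_mono ((ind B hB).const_mul _) ?_ ?_
    · refine Integrable.add (Integrable.sub (Integrable.add ?_ (integrable_const _)) ?_) ?_
      · exact (integrable_finsetSum _ (fun t _ => ind _ (hB.inter (hS t)))).const_mul _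
      · exact (integrable_finsetSum _ (fun t _ => ind _ (hS t))).const_mul _
      · exact integrable_finsetSum _ (fun t _ => integrable_finsetSum _
          (fun s _ => ind _ ((hS t).inter (hS s))))
    · intro ω
      have e1 : ∀ A A' : Set Ω, (A ∩ A').indicator (fun _ => (1 : ℝ)) ω =
          A.indicator (fun _ => (1 : ℝ)) ω * A'.indicator (fun _ => (1 : ℝ)) ω := by
        intro A A'
        by_cases h1 : ω ∈ A <;> by_cases h2 : ω ∈ A' <;> simp [h1, h2]
      simp only [e1]
      simp only [← Finset.mul_sum, ← Finset.sum_mul]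
      set N := ∑ t ∈ Finset.range T, (S t).indicator (fun _ => (1 : ℝ)) ω
      by_cases hω : ω ∈ B
      · simp only [Set.indicator_of_mem hω]
        nlinarith [sq_nonneg N]
      · simp only [Set.indicator_of_notMem hω]
        nlinarith [sq_nonneg (m - N)]
  rw [integral_const_mul, int B hB, integral_add, integral_sub, integral_add,
    integral_const_mul, integral_const_mul, integral_finsetSum, integral_finsetSum,
    integral_finsetSum] at hle
  rotate_left
  · exact fun t _ => integrable_finsetSum _ (fun s _ => ind _ ((hS t).inter (hS s)))
  · exact fun t _ => ind _ (hS t)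
  · exact fun t _ => ind _ (hB.inter (hS t))
  · exact (integrable_finsetSum _ (fun t _ => ind _ (hB.inter (hS t)))).const_mul _
  · exact integrable_const _
  · exact Integrable.add ((integrable_finsetSum _ (fun t _ => ind _ (hB.inter (hS t)))).const_mul _)
      (integrable_const _)
  · exact (integrable_finsetSum _ (fun t _ => ind _ (hS t))).const_mul _
  · exact Integrable.sub (Integrable.add
      ((integrable_finsetSum _ (fun t _ => ind _ (hB.inter (hS t)))).const_mul _)
      (integrable_const _)) ((integrable_finsetSum _ (fun t _ => ind _ (hS t))).const_mul _)
  · exact integrable_finsetSum _ (fun t _ => integrable_finsetSum _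
          (fun s _ => ind _ ((hS t).inter (hS s))))
  have i1 : ∑ t ∈ Finset.range T, ∫ ω, (S t).indicator (fun _ => (1 : ℝ)) ω ∂μ = m := by
    rw [hm]; exact Finset.sum_congr rfl (fun t _ => int _ (hS t))
  have i2 : ∑ t ∈ Finset.range T, ∫ ω, (B ∩ S t).indicator (fun _ => (1 : ℝ)) ω ∂μ ≤ δ * m := by
    rw [hm, Finset.mul_sum]
    exact Finset.sum_le_sum (fun t ht => by
      rw [int _ (hB.inter (hS t))]; exact hδ t (Finset.mem_range.1 ht))
  have i3 : ∑ t ∈ Finset.range T, ∫ ω, ∑ s ∈ Finset.range T,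
      (S t ∩ S s).indicator (fun _ => (1 : ℝ)) ω ∂μ ≤ m + m ^ 2 := by
    have : ∀ t ∈ Finset.range T, ∫ ω, ∑ s ∈ Finset.range T,
      (S t ∩ S s).indicator (fun _ => (1 : ℝ)) ω ∂μ ≤ μ.real (S t) + μ.real (S t) * m := by
      intro t ht
      rw [integral_finsetSum _ (fun s _ => ind _ ((hS t).inter (hS s)))]
      have : ∀ s ∈ Finset.range T, ∫ ω, (S t ∩ S s).indicator (fun _ => (1 : ℝ)) ω ∂μ ≤
          (if t = s then μ.real (S t) else 0) + μ.real (S t) * μ.real (S s) := by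
        intro s _
        rw [int _ ((hS t).inter (hS s))]
        split_ifs with h
        · subst h
          rw [Set.inter_self]
          have : 0 ≤ μ.real (S t) * μ.real (S t) := mul_self_nonneg _
          linarith
        · rw [zero_add]; exact hind t s h
      refine (Finset.sum_le_sum this).trans ?_
      rw [Finset.sum_add_distrib, ← Finset.mul_sum, ← hm, Finset.sum_ite_eq, if_pos ht]
    refine (Finset.sum_le_sum this).trans ?_
    rw [Finset.sum_add_distrib, ← Finset.sum_mul, ← hm]
    nlinarith
  rw [i1] at hle
  simp only [integral_const, probReal_univ, smul_eq_mul, one_mul] at hle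
  have : m ^ 2 * μ.real B ≤ 2 * m * (δ * m) + m := by nlinarith
  have h2 : m ^ 2 * (2 * δ + 1 / m) = 2 * m * (δ * m) + m := by field_simp
  rw [← h2] at this
  exact le_of_mul_le_mul_left this (by positivity)

theorem Conn_box {ω : Config} {a b c d : ℤ} (h : ω ∈ AO (rect a b c d)) :
    ∀ (n : ℕ) (x y : ℤ × ℤ), x ∈ rect a b c d → y ∈ rect a b c d →
      |x.1 - y.1| + |x.2 - y.2| = n → Conn ω (rect a b c d) x y := by
  intro n
  induction n with
  | zero =>
    intro x y hx hy hn
    have h1 := abs_nonneg (x.1 - y.1)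
    have h2 := abs_nonneg (x.2 - y.2)
    have h3 : |x.1 - y.1| = 0 := by push_cast at hn; omega
    have h4 : |x.2 - y.2| = 0 := by push_cast at hn; omega
    rw [abs_eq_zero] at h3 h4
    have : x = y := by ext <;> omega
    subst this
    exact Conn.refl hx (h _ hx)
  | succ n ih =>
    intro x y hx hy hn
    have key : ∃ z, z ∈ rect a b c d ∧ |x.1 - z.1| + |x.2 - z.2| = n ∧ Adjacent z y := by
      rw [mem_rect] at hx hy
      push_cast at hn
      by_cases h1 : x.1 < y.1
      · refine ⟨(y.1 - 1, y.2), by rw [mem_rect]; simp only; omega, ?_, adj_of (by simp)⟩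
        simp only
        rw [abs_of_neg (by omega)] at hn
        rw [abs_of_nonpos (by omega)]; omega
      by_cases h2 : y.1 < x.1
      · refine ⟨(y.1 + 1, y.2), by rw [mem_rect]; simp only; omega, ?_, adj_of (by simp)⟩
        simp only
        rw [abs_of_pos (by omega)] at hn
        rw [abs_of_nonneg (by omega)]; omega
      by_cases h3 : x.2 < y.2
      · refine ⟨(y.1, y.2 - 1), by rw [mem_rect]; simp only; omega, ?_, adj_of (by simp)⟩
        simp only
        rw [abs_of_neg (a := x.2 - y.2) (by omega)] at hn
        rw [abs_of_nonpos (a := x.2 - (y.2 - 1)) (by omega)]; omega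
      by_cases h4 : y.2 < x.2
      · refine ⟨(y.1, y.2 + 1), by rw [mem_rect]; simp only; omega, ?_, adj_of (by simp)⟩
        simp only
        rw [abs_of_pos (a := x.2 - y.2) (by omega)] at hn
        rw [abs_of_nonneg (a := x.2 - (y.2 + 1)) (by omega)]; omega
      have e1 : x.1 - y.1 = 0 := by omega
      have e2 : x.2 - y.2 = 0 := by omega
      rw [e1, e2] at hn
      simp at hn
      omega
    obtain ⟨z, hz, hz', hzy⟩ := key
    exact (ih x z hx hz hz').tail hzy hy (h _ hy)

theorem Conn_bx {ω : Config} {u : ℤ × ℤ} {k : ℤ} (h : ω ∈ AO (bx u k)) {x y : ℤ × ℤ}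
    (hx : x ∈ bx u k) (hy : y ∈ bx u k) : Conn ω (bx u k) x y :=
  Conn_box h (|x.1 - y.1| + |x.2 - y.2|).toNat x y hx hy
    (Int.toNat_of_nonneg (by positivity)).symm

theorem bx_mono (u : ℤ × ℤ) {k M : ℤ} (h : k ≤ M) : bx u k ⊆ bx u M := by
  intro v hv
  rw [mem_bx] at *
  omega

/-- from a seed event to the connection from the centre -/
theorem Conn_seed {ω : Config} {u : ℤ × ℤ} {k M : ℤ} (hk : 0 ≤ k) (hkM : k ≤ M)
    (h : ω ∈ AO (bx u k)) {D : Set (ℤ × ℤ)}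
    (hJ : ω ∈ JE (bx u M) (bx u k) D) : ∃ d ∈ D, Conn ω (bx u M) u d := by
  obtain ⟨a, ha, b, hb, hc⟩ := hJ
  have hu : u ∈ bx u k := by rw [mem_bx]; omega
  exact ⟨b, hb, ((Conn_bx h hu ha).mono (bx_mono u hkM) (fun _ _ h => h)).trans hc⟩

/-- all the events needed around the seed `u` -/
def GE (k M M' a a' : ℤ) (u : ℤ × ℤ) : Set Config :=
  RS u M k a M ∩ (RS u M k (-M) (-a) ∩ (RS u M' k 0 a' ∩ (RS u M' k (-a') 0 ∩ LS u M' k)))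

theorem GE_upper (k M M' a a' : ℤ) (u : ℤ × ℤ) : IsUpperSet (GE k M M' a a' u) :=
  (JE_upper _ _ _).inter ((JE_upper _ _ _).inter ((JE_upper _ _ _).inter
    ((JE_upper _ _ _).inter (JE_upper _ _ _))))

theorem GE_dep {k M M' a a' : ℤ} (h : M ≤ M') (u : ℤ × ℤ) :
    Dep (bx u M') (GE k M M' a a' u) :=
  ((JE_dep _ _ _).mono (bx_mono u h)).inter (((JE_dep _ _ _).mono (bx_mono u h)).inter
    ((JE_dep _ _ _).inter ((JE_dep _ _ _).inter (JE_dep _ _ _))))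

theorem pair_conn {ω : Config} {k m M M' a a' : ℤ} {u v : ℤ × ℤ} (hk : 0 ≤ k) (hkM : k ≤ M)
    (hm : 0 ≤ m) (hM' : M' = M + m) (ha : a' ≤ 2 * a) 
    (hv : v.1 = u.1 - m) (hv2 : v.2 = u.2 - a ∨ v.2 = u.2 + a)
    (hu : ω ∈ AO (bx u k)) (hv' : ω ∈ AO (bx v k)) (hGu : ω ∈ GE k M M' a a' u)
    (hGv : ω ∈ GE k M M' a a' v) : Conn ω (bx u M' ∪ bx v M') u v := by
  obtain ⟨g1, g2, -, -, -⟩ := hGu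
  obtain ⟨-, -, g3, g4, g5⟩ := hGv
  obtain ⟨t1, ⟨p1, p1', p1''⟩, c1⟩ := Conn_seed hk hkM hu g1
  obtain ⟨t2, ⟨p2, p2', p2''⟩, c2⟩ := Conn_seed hk hkM hu g2
  obtain ⟨t5, ⟨p5, p5', p5''⟩, c5⟩ := Conn_seed hk (by omega) hv' g5
  have h3 : ∃ d : ℤ × ℤ, d.1 = u.1 + M ∧ u.2 - a ≤ d.2 ∧ d.2 ≤ u.2 + a ∧
      Conn ω (bx v M') v d := by
    rcases hv2 with hv2 | hv2
    · obtain ⟨t, ⟨q1, q2, q3⟩, c3⟩ := Conn_seed hk (by omega) hv' g3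
      exact ⟨t, by omega, by omega, by omega, c3⟩
    · obtain ⟨t, ⟨q1, q2, q3⟩, c3⟩ := Conn_seed hk (by omega) hv' g4
      exact ⟨t, by omega, by omega, by omega, c3⟩
  obtain ⟨d, d1, d2, d3, c3⟩ := h3
  obtain ⟨z, z1, z2⟩ := Conn.enclose (c2.symm.trans c1) (c5.symm.trans c3)
    (fun z hz => by rw [mem_bx] at hz; omega) (fun z hz => by rw [mem_bx] at hz; omega)
    (by omega) (by omega) (by omega) (by omega)
  have e1 := (c2.trans z1).mono (T := bx u M' ∪ bx v M')
    ((bx_mono u (by omega)).trans Set.subset_union_left) (fun _ _ h => h)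
  have e2 := (c5.trans z2).mono (T := bx u M' ∪ bx v M') Set.subset_union_right (fun _ _ h => h)
  exact e1.trans e2.symm

/-- the chain of seeds -/
def zp (m a K : ℤ) (t i : ℕ) : ℤ × ℤ := (-(i * m), K * t + if i % 2 = 0 then 0 else a)

theorem chain_conn {ω : Config} {k m M M' a a' K : ℤ} (hk : 0 ≤ k) (hkM : k ≤ M)
    (hm : 0 ≤ m) (hM' : M' = M + m) (ha0 : 0 ≤ a) (ha1 : a ≤ M) (ha : a' ≤ 2 * a)
    (hK : 0 ≤ K) (t : ℕ) (hKt : K * t ≤ M) (hmM : 2 * m ≤ M) (J : ℕ)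
    (h1 : ∀ i ≤ J, ω ∈ AO (bx (zp m a K t i) k))
    (h2 : ∀ i ≤ J, ω ∈ GE k M M' a a' (zp m a K t i)) :
    Conn ω (rect (- (J * m + M')) M' (- (2 * M)) (4 * M)) (zp m a K t 0) (zp m a K t J) := by
  have hKt0 : 0 ≤ K * t := by positivity
  have hbx : ∀ i ≤ J, bx (zp m a K t i) M' ⊆ rect (- (J * m + M')) M' (- (2 * M)) (4 * M) := by
    intro i hi v hv
    rw [mem_bx] at hv
    rw [mem_rect]
    have : (i : ℤ) * m ≤ J * m := by
      have : (i : ℤ) ≤ J := by exact_mod_cast hi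
      gcongr
    have : 0 ≤ (i : ℤ) * m := by positivity
    simp only [zp] at hv
    split_ifs at hv <;> omega
  have : ∀ i ≤ J, Conn ω (rect (- (J * m + M')) M' (- (2 * M)) (4 * M))
      (zp m a K t 0) (zp m a K t i) := by
    intro i
    induction i with
    | zero =>
      intro _
      have hu : zp m a K t 0 ∈ bx (zp m a K t 0) k := by rw [mem_bx]; omega
      exact Conn.refl (hbx 0 (Nat.zero_le _) (bx_mono _ (by omega) hu)) (h1 0 (Nat.zero_le _) _ hu)
    | succ i ih =>
      intro hi
      have hi' : i ≤ J := by omega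
      refine (ih hi').trans ((pair_conn hk hkM hm hM' ha ?_ ?_ (h1 i hi') (h1 _ hi) (h2 i hi')
        (h2 _ hi)).mono (Set.union_subset (hbx i hi') (hbx _ hi)) (fun _ _ h => h))
      · simp only [zp]; push_cast; ring
      · simp only [zp]
        have : i % 2 = 0 ∨ i % 2 = 1 := by omega
        rcases this with h | h
        · have : (i + 1) % 2 = 1 := by omega
          simp [h, this]
        · have : (i + 1) % 2 = 0 := by omega
          simp [h, this]
  exact this J le_rfl

/-- left-right crossing of a long rectangle -/
def HC (L : ℤ) : Set Config := JE (rect 0 (3 * L - 1) 0 (L - 1)) {v | v.1 = 0} {v | v.1 = 3 * L - 1}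

theorem chain_cross {ω : Config} {k m M M' a a' K : ℤ} (hk : 0 ≤ k) (hkM : k ≤ M)
    (hm : 0 ≤ m) (hM' : M' = M + m) (ha0 : 0 ≤ a) (ha1 : a ≤ M) (ha : a' ≤ 2 * a)
    (hK : 0 ≤ K) (t : ℕ) (hKt : K * t ≤ M) (hmM : 2 * m ≤ M) (hmM' : M ≤ 3 * m) (hM0 : 1 ≤ M)
    (h1 : ∀ i < 64, ω ∈ AO (bx (zp m a K t i) k))
    (h2 : ∀ i < 64, ω ∈ GE k M M' a a' (zp m a K t i)) :
    ω ∈ JE (rect (-(21 * M) + 1) 0 (-(2 * M)) (5 * M - 1)) {v | v.1 = -(21 * M) + 1}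
      {v | v.1 = 0} := by
  have hc := chain_conn hk hkM hm hM' ha0 ha1 ha hK t hKt hmM 63 (fun i hi => h1 i (by omega))
    (fun i hi => h2 i (by omega))
  obtain ⟨x, y, hx, hy, hxy⟩ := hc.symm.cut (fun v => v.1) lip_fst (l := -(21 * M) + 1) (r := 0)
    (by omega) (by simp only [zp]; push_cast; omega) (by simp only [zp]; push_cast; omega)
  refine ⟨x, hx, y, hy, hxy.mono ?_ (fun _ _ h => h)⟩
  rintro z ⟨hz, hz', hz''⟩
  rw [mem_rect] at *
  omega

end Perc

namespace Perc

theorem Dep.all {F : Set (ℤ × ℤ)} {A : ℕ → Set Config} {n : ℕ} (h : ∀ i < n, Dep F (A i)) :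
    Dep F {ω | ∀ i < n, ω ∈ A i} := by
  intro ω ω' hω
  simp only [Set.mem_ofPred_eq]
  exact forall₂_congr (fun i hi => h i hi ω ω' hω)

theorem upper_all {A : ℕ → Set Config} {n : ℕ} (h : ∀ i < n, IsUpperSet (A i)) :
    IsUpperSet {ω | ∀ i < n, ω ∈ A i} :=
  fun _ _ hle hω i hi => h i hi hle (hω i hi)

theorem compl_inter_le (μ : Measure Config) [IsProbabilityMeasure μ] {A B : Set Config}
    (hB : MeasurableSet B) :
    1 - μ.real (A ∩ B) ≤ (1 - μ.real A) + (1 - μ.real B) := by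
  have h2 := measureReal_union_add_inter (μ := μ) (s := A) (t := B) hB
  have := measureReal_le_one (μ := μ) (s := A ∪ B)
  linarith

theorem compl_all_le (μ : Measure Config) [IsProbabilityMeasure μ] {A : ℕ → Set Config} (n : ℕ)
    (hA : ∀ i, MeasurableSet (A i)) (δ : ℝ) (h : ∀ i, 1 - μ.real (A i) ≤ δ) :
    1 - μ.real {ω | ∀ i < n, ω ∈ A i} ≤ n * δ := by
  induction n with
  | zero => simp [Set.ofPred_true]
  | succ n ih =>
    have e : {ω | ∀ i < n + 1, ω ∈ A i} = {ω | ∀ i < n, ω ∈ A i} ∩ A n := by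
      ext ω
      exact Nat.forall_lt_succ_right
    rw [e]
    have := compl_inter_le μ (A := {ω | ∀ i < n, ω ∈ A i}) (hA n)
    have := h n
    push_cast
    linarith

/-- finset version of the seed box -/
noncomputable def bxF (c : ℤ × ℤ) (r : ℤ) : Finset (ℤ × ℤ) :=
  Finset.Icc (c.1 - r) (c.1 + r) ×ˢ Finset.Icc (c.2 - r) (c.2 + r)

theorem mem_bxF {c v : ℤ × ℤ} {r : ℤ} : v ∈ bxF c r ↔ v ∈ bx c r := by
  simp only [bxF, Finset.mem_product, Finset.mem_Icc, mem_bx]; tauto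

theorem card_bxF (c : ℤ × ℤ) (k : ℕ) : (bxF c k).card = (2 * k + 1) ^ 2 := by
  simp only [bxF, Finset.card_product, Int.card_Icc]
  rw [sq]
  congr 1 <;> omega

/-- all seeds of the row `t` -/
noncomputable def sdF (m a K k : ℤ) (t : ℕ) : Finset (ℤ × ℤ) :=
  (Finset.range 64).biUnion (fun i => bxF (zp m a K t i) k)

theorem card_sdF (m a K : ℤ) (k : ℕ) (t : ℕ) : (sdF m a K k t).card ≤ 64 * (2 * k + 1) ^ 2 := by
  refine Finset.card_biUnion_le.trans ?_
  simp only [card_bxF, Finset.sum_const, Finset.card_range, smul_eq_mul]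
  exact le_rfl

theorem sdF_disj {m a k : ℤ} (hk : 0 ≤ k) (hm : 2 * k + 1 ≤ m) {t s : ℕ} (hts : t ≠ s) :
    Disjoint (sdF m a (2 * k + 1) k t : Set (ℤ × ℤ)) (sdF m a (2 * k + 1) k s) := by
  rw [Set.disjoint_left]
  intro v hv hv'
  simp only [sdF, Finset.mem_coe, Finset.mem_biUnion, mem_bxF, mem_bx, zp] at hv hv'
  obtain ⟨i, -, h1, h2, h3, h4⟩ := hv
  obtain ⟨j, -, g1, g2, g3, g4⟩ := hv'
  rcases lt_trichotomy i j with h | h | h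
  · have : (i : ℤ) * m + m ≤ j * m := by
      have : (i : ℤ) + 1 ≤ j := by exact_mod_cast h
      nlinarith
    omega
  · subst h
    have : (2 * k + 1) * (t : ℤ) + (2 * k + 1) ≤ (2 * k + 1) * s ∨
        (2 * k + 1) * (s : ℤ) + (2 * k + 1) ≤ (2 * k + 1) * t := by
      rcases lt_or_gt_of_ne hts with h | h
      · left
        have : (t : ℤ) + 1 ≤ s := by exact_mod_cast h
        nlinarith
      · right
        have : (s : ℤ) + 1 ≤ t := by exact_mod_cast h
        nlinarith
    omega
  · have : (j : ℤ) * m + m ≤ i * m := by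
      have : (j : ℤ) + 1 ≤ i := by exact_mod_cast h
      nlinarith
    omega


theorem GE_prob {p : ℝ} (hp0 : 0 ≤ p) (hp1 : p ≤ 1) {μ : Measure Config}
    (hμ : IsBernoulliProduct p μ) {k M M' a a' : ℤ} (haM : a' ≤ M') (hM' : 0 ≤ M') {ε : ℝ}
    (h1 : 1 - ε ≤ μ.real (RS 0 M k a M)) (h2 : 1 - ε ≤ μ.real (RS 0 M' k 0 a')) (u : ℤ × ℤ) :
    1 - μ.real (GE k M M' a a' u) ≤ 5 * ε := by
  have := hμ.1
  have mj : ∀ (u : ℤ × ℤ) (r : ℤ) (A B : Set (ℤ × ℤ)), MeasurableSet (JE (bx u r) A B) :=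
    fun u r A B => (JE_dep _ _ _).meas (bx_finite _ _)
  have c1 := compl_inter_le μ (A := RS u M k a M)
    (B := (RS u M k (-M) (-a) ∩ (RS u M' k 0 a' ∩ (RS u M' k (-a') 0 ∩ LS u M' k))))
    ((mj _ _ _ _).inter ((mj _ _ _ _).inter ((mj _ _ _ _).inter (mj _ _ _ _))))
  have c2 := compl_inter_le μ (A := RS u M k (-M) (-a))
    (B := (RS u M' k 0 a' ∩ (RS u M' k (-a') 0 ∩ LS u M' k)))
    ((mj _ _ _ _).inter ((mj _ _ _ _).inter (mj _ _ _ _)))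
  have c3 := compl_inter_le μ (A := RS u M' k 0 a') (B := (RS u M' k (-a') 0 ∩ LS u M' k))
    ((mj _ _ _ _).inter (mj _ _ _ _))
  have c4 := compl_inter_le μ (A := RS u M' k (-a') 0) (B := LS u M' k) (mj _ _ _ _)
  have e1 := RS_tr hp0 hp1 hμ u M k a M
  have e2 := RS_tr hp0 hp1 hμ u M k (-M) (-a)
  have e3 := RS_tr hp0 hp1 hμ u M' k 0 a'
  have e4 := RS_tr hp0 hp1 hμ u M' k (-a') 0
  have e5 := LS_tr hp0 hp1 hμ u M' k
  rw [RS_flip hp0 hp1 hμ] at e2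
  have f4 := RS_flip hp0 hp1 hμ M' k 0 a'
  rw [neg_zero] at f4
  rw [LS_flip hp0 hp1 hμ] at e5
  have g5 : μ.real (RS 0 M' k 0 a') ≤ μ.real (RS 0 M' k (-M') M') := by
    refine measureReal_mono (JE_mono le_rfl le_rfl ?_)
    intro v hv
    simp at hv ⊢
    omega
  unfold GE
  linarith

theorem HC_good {p : ℝ} (hp0 : 0 ≤ p) (hp1 : p ≤ 1) {μ : Measure Config}
    (hμ : IsBernoulliProduct p μ) {k M m M' a a' T : ℕ} (hm : m = M / 2) (hM' : M' = M + m) (hM : 4 * k + 3 ≤ M)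
    (hT : (2 * k + 1) * T ≤ M) (ha : a ≤ M) (ha' : a' ≤ 2 * a) (haM : a' ≤ M')
    (h1 : 1 - 1 / 100000 ≤ μ.real (RS 0 M k a M))
    (h2 : 1 - 1 / 100000 ≤ μ.real (RS 0 M' k 0 a'))
    (hTp : 1000 ≤ T * p ^ (64 * (2 * k + 1) ^ 2)) :
    1 - 1 / 100 ≤ μ.real (HC (7 * M)) := by
  have := hμ.1
  set K : ℤ := 2 * (k : ℤ) + 1 with hK
  set C := JE (rect (-(21 * M) + 1) 0 (-(2 * M)) (5 * M - 1)) {v | v.1 = -(21 * (M : ℤ)) + 1}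
      {v | v.1 = 0} with hC
  set S : ℕ → Set Config := fun t => AO (sdF m a K k t) with hS
  set W : ℕ → Set Config := fun t => {ω | ∀ i < 64, ω ∈ GE k M M' a a' (zp m a K t i)} with hW
  have mS : ∀ t, MeasurableSet (S t) := fun t => (AO_dep _).meas (Finset.finite_toSet _)
  have mC : MeasurableSet C := (JE_dep _ _ _).meas (rect_finite _ _ _ _)
  have hsub : ∀ t < T, S t ∩ W t ⊆ C := by
    rintro t ht ω ⟨hω1, hω2⟩
    refine chain_cross (k := k) (m := m) (M := M) (M' := M') (a := a) (a' := a') (K := K)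
      (by omega) (by omega) (by omega) (by omega) (by omega) (by omega) (by omega)
      (by omega) t ?_ (by omega) (by omega) (by omega) ?_ hω2
    · have : (K : ℤ) * t ≤ K * T := by
        have : (t : ℤ) ≤ T := by exact_mod_cast ht.le
        gcongr
      have h3 : (K : ℤ) * T ≤ M := by rw [hK]; exact_mod_cast hT
      omega
    · intro i hi v hv
      refine hω1 v ?_
      simp only [sdF, Finset.mem_coe, Finset.mem_biUnion, mem_bxF, Finset.mem_range]
      exact ⟨i, hi, hv⟩
  have hGm : ∀ u, MeasurableSet (GE k M M' a a' u) :=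
    fun u => (GE_dep (by omega) u).meas (bx_finite _ _)
  have hWp : ∀ t, 1 - μ.real (W t) ≤ 64 * (5 * (1 / 100000)) := by
    intro t
    have := compl_all_le μ 64 (A := fun i => GE k M M' a a' (zp m a K t i)) (fun i => hGm _)
      (5 * (1 / 100000)) (fun i => GE_prob hp0 hp1 hμ (by omega) (by omega) h1 h2 _)
    exact_mod_cast this
  have hδ : ∀ t < T, μ.real (Cᶜ ∩ S t) ≤ (64 * (5 * (1 / 100000))) * μ.real (S t) := by
    intro t ht
    have i1 : Cᶜ ∩ S t ⊆ S t \ (S t ∩ W t) := by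
      rintro ω ⟨hω, hω'⟩
      exact ⟨hω', fun h => hω (hsub t ht h)⟩
    have fin : (⋃ i ∈ Finset.range 64, bx (zp m a K t i) M').Finite :=
      Set.Finite.biUnion (Finset.finite_toSet _) (fun i _ => bx_finite _ _)
    have dS : Dep (⋃ i ∈ Finset.range 64, bx (zp m a K t i) M') (S t) := by
      refine (AO_dep _).mono ?_
      intro v hv
      simp only [sdF, Finset.mem_coe, Finset.mem_biUnion, mem_bxF] at hv
      obtain ⟨i, hi, hv⟩ := hv
      simp only [Set.mem_iUnion]
      exact ⟨i, hi, bx_mono _ (by omega) hv⟩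
    have dW : Dep (⋃ i ∈ Finset.range 64, bx (zp m a K t i) M') (W t) := by
      refine Dep.all (fun i hi => (GE_dep (by omega) _).mono ?_)
      intro v hv
      simp only [Set.mem_iUnion]
      exact ⟨i, Finset.mem_range.2 hi, hv⟩
    have hh := harris hp0 hp1 hμ fin dS dW (AO_upper _) (upper_all (fun i _ => GE_upper _ _ _ _ _ _))
    have i2 := measureReal_mono (μ := μ) i1
    rw [measureReal_sdiff Set.inter_subset_left ((dS.inter dW).meas fin)] at i2
    have := hWp t
    have : 0 ≤ μ.real (S t) := measureReal_nonneg
    nlinarith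
  have hind : ∀ t s, t ≠ s → μ.real (S t ∩ S s) ≤ μ.real (S t) * μ.real (S s) := by
    intro t s hts
    exact (indep hp0 hp1 hμ (Finset.finite_toSet _) (Finset.finite_toSet _)
      (sdF_disj (by omega) (by omega) hts) (AO_dep _) (AO_dep _)).le
  have hm0 : 1000 ≤ ∑ t ∈ Finset.range T, μ.real (S t) := by
    refine hTp.trans ?_
    rw [← nsmul_eq_mul]
    conv_lhs => rw [← Finset.card_range T]
    refine Finset.card_nsmul_le_sum _ _ _ (fun t _ => ?_)
    simp only [hS]
    rw [AO_real hp0 hp1 hμ]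
    exact pow_le_pow_of_le_one hp0 hp1 (card_sdF _ _ _ _ _)
  have key := second_moment μ T S mS Cᶜ mC.compl hind _ hδ _ rfl (by linarith)
  rw [probReal_compl_eq_one_sub mC] at key
  have h5 : 1 / (∑ t ∈ Finset.range T, μ.real (S t)) ≤ 1 / 1000 :=
    one_div_le_one_div_of_le (by norm_num) hm0
  have h6 : μ.real (HC (7 * M)) = μ.real C := by
    refine JE_tr hp0 hp1 hμ (21 * M - 1, 2 * M) (rect_finite _ _ _ _) (fun v => ?_) (fun v => ?_)
      (fun v => ?_)
    · simp only [mem_rect]; simp; omega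
    · simp; omega
    · simp; omega
  rw [h6]
  norm_num at key h5 ⊢
  linarith


theorem HC_start {p : ℝ} (hpc : siteCriticalProbability < p)
    (hp1 : p ≤ 1) {μ : Measure Config} (hμ : IsBernoulliProduct p μ) :
    ∃ L : ℕ, 1 ≤ L ∧ 1 - 1 / 100 ≤ μ.real (HC L) := by
  have hp : 0 < p := lt_of_le_of_lt pc_nonneg hpc
  have hp0 := hp.le
  obtain ⟨θ, hθ, hθ'⟩ := theta_pos hpc hp1 hμ
  obtain ⟨k, hk⟩ := seed_exists hp0 hp1 hμ hθ hθ' (ε := (1 / 100000) ^ 16) (by positivity)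
  have hα : ∀ M : ℕ, ∃ a : ℕ, k ≤ M → (a ≤ M ∧ 1 - 1 / 100000 ≤ μ.real (RS 0 M k a M) ∧
      1 - 1 / 100000 ≤ μ.real (RS 0 M k 0 a)) := by
    intro M
    by_cases hM : k ≤ M
    · obtain ⟨a, ha⟩ := alpha_exists hp0 hp1 hμ (ε := 1 / 100000) (by norm_num) (by norm_num) (hk M hM)
      exact ⟨a, fun _ => ha⟩
    · exact ⟨0, fun h => absurd h hM⟩
  choose α hα using hα
  have hF : 0 < p ^ (64 * (2 * k + 1) ^ 2) := by positivity
  obtain ⟨T, hT⟩ := exists_nat_ge (1000 / p ^ (64 * (2 * k + 1) ^ 2))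
  rw [div_le_iff₀ hF] at hT
  obtain ⟨M, hM, hM2⟩ := good_scale α k (4 * k + 3 + (2 * k + 1) * T) (fun M hM => (hα M hM).1)
  obtain ⟨a1, a2, -⟩ := hα M (by omega)
  obtain ⟨b1, -, b3⟩ := hα (M + M / 2) (by omega)
  refine ⟨7 * M, by omega, ?_⟩
  have := HC_good hp0 hp1 hμ (k := k) (M := M) (m := M / 2) (M' := M + M / 2) (a := α M)
    (a' := α (M + M / 2)) (T := T) rfl rfl (by omega) (by omega) a1 hM2 b1 a2 b3 hT
  push_cast
  exact this

end Perc

namespace Perc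

/-- crossing of a long strip -/
def ST (L c : ℤ) : Set Config :=
  JE (rect 0 (6 * L - 1) c (c + L - 1)) {v | v.1 = 0} {v | v.1 = 6 * L - 1}

/-- horizontal crossing of a shifted rectangle -/
def HX (L x : ℤ) : Set Config :=
  JE (rect x (x + 3 * L - 1) 0 (L - 1)) {v | v.1 = x} {v | v.1 = x + 3 * L - 1}

/-- vertical crossing of a shifted rectangle -/
def VX (L x : ℤ) : Set Config :=
  JE (rect x (x + L - 1) 0 (3 * L - 1)) {v | v.2 = 0} {v | v.2 = 3 * L - 1}

theorem strip_det {ω : Config} {L : ℤ} (hL : 1 ≤ L) (h0 : ω ∈ HX L 0) (h2 : ω ∈ HX L (2 * L))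
    (h3 : ω ∈ HX L (3 * L)) (v2 : ω ∈ VX L (2 * L)) (v3 : ω ∈ VX L (3 * L)) : ω ∈ ST L 0 := by
  have vcut : ∀ x : ℤ, ω ∈ VX L x → ∃ a a' : ℤ × ℤ, a.2 = 0 ∧ a'.2 = L - 1 ∧
      Conn ω (rect x (x + L - 1) 0 (L - 1)) a a' := by
    rintro x ⟨a, ha, a', ha', hc⟩
    simp only [Set.mem_ofPred_eq] at ha ha'
    obtain ⟨b, b', hb, hb', hd⟩ := hc.cut (fun v => v.2) lip_snd (l := 0) (r := L - 1)
      (by omega) (by omega) (by omega)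
    refine ⟨b, b', hb, hb', hd.mono ?_ (fun _ _ h => h)⟩
    rintro z ⟨hz, hz', hz''⟩
    rw [mem_rect] at *
    omega
  obtain ⟨a2, a2', e1, e2, cv2⟩ := vcut _ v2
  obtain ⟨a3, a3', e3, e4, cv3⟩ := vcut _ v3
  obtain ⟨b0, f0, b0', f0', c0⟩ := h0
  obtain ⟨b2, f2, b2', f2', c2⟩ := h2
  obtain ⟨b3, f3, b3', f3', c3⟩ := h3
  simp only [Set.mem_ofPred_eq] at f0 f0' f2 f2' f3 f3'
  obtain ⟨z1, p1, q1⟩ := cv2.cross c0 (fun z hz => by rw [mem_rect] at hz; omega)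
    (fun z hz => by rw [mem_rect] at hz; omega)
  obtain ⟨z2, p2, q2⟩ := cv2.cross c2 (fun z hz => by rw [mem_rect] at hz; omega)
    (fun z hz => by rw [mem_rect] at hz; omega)
  obtain ⟨z3, p3, q3⟩ := cv3.cross c2 (fun z hz => by rw [mem_rect] at hz; omega)
    (fun z hz => by rw [mem_rect] at hz; omega)
  obtain ⟨z4, p4, q4⟩ := cv3.cross c3 (fun z hz => by rw [mem_rect] at hz; omega)
    (fun z hz => by rw [mem_rect] at hz; omega)
  have up : ∀ {x y : ℤ} {u v : ℤ × ℤ}, 0 ≤ x → y ≤ 6 * L - 1 → Conn ω (rect x y 0 (L - 1)) u v →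
      Conn ω (rect 0 (6 * L - 1) 0 (0 + L - 1)) u v := by
    intro x y u v hx hy h
    refine h.mono ?_ (fun _ _ h => h)
    intro z hz
    rw [mem_rect] at *
    omega
  have r1 := up (by omega) (by omega) q1
  have r2 := up (by omega) (by omega) (p1.symm.trans p2)
  have r3 := up (by omega) (by omega) (q2.symm.trans q3)
  have r4 := up (by omega) (by omega) (p3.symm.trans p4)
  have r5 := up (by omega) (by omega) (q4.symm.trans c3)
  exact ⟨b0, f0, b3', by simp only [Set.mem_ofPred_eq]; omega,
    r1.trans (r2.trans (r3.trans (r4.trans r5)))⟩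


theorem HX_eq {p : ℝ} (hp0 : 0 ≤ p) (hp1 : p ≤ 1) {μ : Measure Config}
    (hμ : IsBernoulliProduct p μ) (L x : ℤ) : μ.real (HX L x) = μ.real (HC L) := by
  refine JE_tr hp0 hp1 hμ (x, 0) (rect_finite _ _ _ _) (fun v => ?_) (fun v => ?_) (fun v => ?_)
  · simp only [mem_rect]; simp; omega
  · simp
  · simp; omega

theorem VX_eq {p : ℝ} (hp0 : 0 ≤ p) (hp1 : p ≤ 1) {μ : Measure Config}
    (hμ : IsBernoulliProduct p μ) (L x : ℤ) : μ.real (VX L x) = μ.real (HC L) := by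
  have h1 : μ.real (VX L x) = μ.real (VX L 0) := by
    refine JE_tr hp0 hp1 hμ (x, 0) (rect_finite _ _ _ _) (fun v => ?_) (fun v => ?_) (fun v => ?_)
    · simp only [mem_rect]; simp; omega
    · simp
    · simp
  rw [h1]
  refine JE_swap hp0 hp1 hμ (rect_finite _ _ _ _) (fun v => ?_) (fun v => ?_) (fun v => ?_)
  · simp only [mem_rect]; simp; omega
  · simp
  · simp

theorem ST_eq {p : ℝ} (hp0 : 0 ≤ p) (hp1 : p ≤ 1) {μ : Measure Config}
    (hμ : IsBernoulliProduct p μ) (L c : ℤ) : μ.real (ST L c) = μ.real (ST L 0) := by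
  refine JE_tr hp0 hp1 hμ (0, c) (rect_finite _ _ _ _) (fun v => ?_) (fun v => ?_) (fun v => ?_)
  · simp only [mem_rect]; simp; omega
  · simp
  · simp

theorem ST_prob {p : ℝ} (hp0 : 0 ≤ p) (hp1 : p ≤ 1) {μ : Measure Config}
    (hμ : IsBernoulliProduct p μ) {L : ℤ} (hL : 1 ≤ L) : 1 - μ.real (ST L 0) ≤ 5 * (1 - μ.real (HC L)) := by
  have := hμ.1
  have mj : ∀ (a b c d : ℤ) (A B : Set (ℤ × ℤ)), MeasurableSet (JE (rect a b c d) A B) :=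
    fun a b c d A B => (JE_dep _ _ _).meas (rect_finite _ _ _ _)
  have hs : HX L 0 ∩ (HX L (2 * L) ∩ (HX L (3 * L) ∩ (VX L (2 * L) ∩ VX L (3 * L)))) ⊆ ST L 0 := by
    rintro ω ⟨h1, h2, h3, h4, h5⟩
    exact strip_det hL h1 h2 h3 h4 h5
  have h := measureReal_mono (μ := μ) hs
  have c1 := compl_inter_le μ (A := HX L 0)
    (B := (HX L (2 * L) ∩ (HX L (3 * L) ∩ (VX L (2 * L) ∩ VX L (3 * L)))))
    ((mj _ _ _ _ _ _).inter ((mj _ _ _ _ _ _).inter ((mj _ _ _ _ _ _).inter (mj _ _ _ _ _ _))))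
  have c2 := compl_inter_le μ (A := HX L (2 * L))
    (B := ((HX L (3 * L) ∩ (VX L (2 * L) ∩ VX L (3 * L)))))
    (((mj _ _ _ _ _ _).inter ((mj _ _ _ _ _ _).inter (mj _ _ _ _ _ _))))
  have c3 := compl_inter_le μ (A := HX L (3 * L))
    (B := (((VX L (2 * L) ∩ VX L (3 * L)))))
    ((((mj _ _ _ _ _ _).inter (mj _ _ _ _ _ _))))
  have c4 := compl_inter_le μ (A := VX L (2 * L)) (B := VX L (3 * L)) (mj _ _ _ _ _ _)
  rw [HX_eq hp0 hp1 hμ] at c1 c2 c3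
  rw [VX_eq hp0 hp1 hμ, VX_eq hp0 hp1 hμ] at c4
  linarith

theorem renorm {p : ℝ} (hp0 : 0 ≤ p) (hp1 : p ≤ 1) {μ : Measure Config}
    (hμ : IsBernoulliProduct p μ) {L : ℤ} (hL : 1 ≤ L) :
    1 - μ.real (HC (2 * L)) ≤ 25 * (1 - μ.real (HC L)) ^ 2 := by
  have := hμ.1
  have mST : ∀ c, MeasurableSet (ST L c) := fun c => (JE_dep _ _ _).meas (rect_finite _ _ _ _)
  have mHC : MeasurableSet (HC (2 * L)) := (JE_dep _ _ _).meas (rect_finite _ _ _ _)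
  have hs : (HC (2 * L))ᶜ ⊆ (ST L 0)ᶜ ∩ (ST L L)ᶜ := by
    intro ω hω
    have e : ∀ c : ℤ, 0 ≤ c → c ≤ L → ST L c ⊆ HC (2 * L) := by
      intro c hc hc'
      refine JE_mono ?_ le_rfl ?_
      · intro v hv
        rw [mem_rect] at *
        omega
      · intro v hv
        simp only [Set.mem_ofPred_eq] at *
        omega
    exact ⟨fun h => hω (e 0 le_rfl (by omega) h), fun h => hω (e L (by omega) le_rfl h)⟩
  have h := measureReal_mono (μ := μ) hs
  have dST : ∀ c, Dep (rect 0 (6 * L - 1) c (c + L - 1)) (ST L c) := fun c => JE_dep _ _ _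
  rw [indep hp0 hp1 hμ (rect_finite _ _ _ _) (rect_finite _ _ _ _) ?_ (dST 0).compl
    (dST L).compl, probReal_compl_eq_one_sub mHC] at h
  · rw [probReal_compl_eq_one_sub (mST _), probReal_compl_eq_one_sub (mST _),
      ST_eq hp0 hp1 hμ L L] at h
    have h1 := ST_prob hp0 hp1 hμ hL
    have h2 : 0 ≤ 1 - μ.real (ST L 0) := by
      linarith [measureReal_le_one (μ := μ) (s := ST L 0)]
    nlinarith
  · rw [Set.disjoint_left]
    intro v hv hv'
    rw [mem_rect] at *
    omega

theorem HC_exp {p : ℝ} (hp0 : 0 ≤ p) (hp1 : p ≤ 1) {μ : Measure Config}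
    (hμ : IsBernoulliProduct p μ) {L : ℕ} (hL : 1 ≤ L) (h : 1 - 1 / 100 ≤ μ.real (HC L)) (j : ℕ) :
    25 * (1 - μ.real (HC ((2 ^ j * L : ℕ) : ℤ))) ≤ Real.exp (-2 ^ j) := by
  have := hμ.1
  induction j with
  | zero =>
    simp only [pow_zero, one_mul]
    have h1 : (1 : ℝ) / 4 ≤ Real.exp (-1) := by
      rw [Real.exp_neg, ← one_div]
      exact one_div_le_one_div_of_le (Real.exp_pos _) (by linarith [Real.exp_one_lt_d9])
    linarith
  | succ j ih =>
    have h1 : (1 : ℤ) ≤ ((2 ^ j * L : ℕ) : ℤ) := by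
      have : 0 < 2 ^ j * L := by positivity
      omega
    have h2 := renorm hp0 hp1 hμ h1
    have e : (2 : ℤ) * ((2 ^ j * L : ℕ) : ℤ) = ((2 ^ (j + 1) * L : ℕ) : ℤ) := by
      push_cast; ring
    rw [e] at h2
    have h3 : Real.exp (-2 ^ (j + 1)) = Real.exp (-2 ^ j) ^ 2 := by
      rw [← Real.exp_nat_mul]; congr 1; push_cast; ring
    rw [h3]
    have h4 : 0 ≤ 1 - μ.real (HC ((2 ^ j * L : ℕ) : ℤ)) := by
      linarith [measureReal_le_one (μ := μ) (s := HC ((2 ^ j * L : ℕ) : ℤ))]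
    have h5 := pow_le_pow_left₀ (by positivity) ih 2
    nlinarith


theorem HC_cluster {ω : Config} {L : ℤ} {n : ℕ} (h1 : L ≤ n + 1) (h2 : (n : ℤ) ≤ 3 * L - 1)
    (h : ω ∈ HC L) : ∃ v ∈ box0 n, (n : ℕ∞) ≤ (cluster ω (box0 n) v).encard := by
  obtain ⟨a, ha, b, hb, hc⟩ := h
  simp only [Set.mem_ofPred_eq] at ha hb
  obtain ⟨a', b', ha', hb', hd⟩ := hc.cut (fun v => v.1) lip_fst (l := 0) (r := n)
    (by omega) (by omega) (by omega)
  have hd' : Conn ω (box0 n) a' b' := by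
    refine hd.mono ?_ (fun _ _ h => h)
    rintro z ⟨hz, hz', hz''⟩
    rw [mem_rect] at hz
    simp only [box0, Set.mem_ofPred_eq]
    omega
  refine ⟨a', hd'.1, ?_⟩
  have key : ∀ i : ℤ, 0 ≤ i → i ≤ b'.1 → ∃ w, Conn ω (box0 n) a' w ∧ w.1 = i := by
    refine hd'.induct (fun z => ∀ i : ℤ, 0 ≤ i → i ≤ z.1 → ∃ w, Conn ω (box0 n) a' w ∧ w.1 = i)
      ?_ ?_
    · intro i hi hi'
      exact ⟨a', Conn.refl hd'.1 hd'.2.1, by omega⟩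
    · intro x y hx hxy hy hy' ih i hi hi'
      by_cases hix : i ≤ x.1
      · exact ih i hi hix
      · exact ⟨y, hx.tail hxy hy hy', by have := adj_cases hxy; omega⟩
  have hsub : Set.Icc (0 : ℤ) n ⊆ Prod.fst '' (cluster ω (box0 n) a') := by
    rintro i ⟨hi, hi'⟩
    obtain ⟨w, hw, rfl⟩ := key i hi (by omega)
    exact ⟨w, hw, rfl⟩
  calc (n : ℕ∞) ≤ (Set.Icc (0 : ℤ) n).encard := by
        rw [← Finset.coe_Icc, Set.encard_coe_eq_coe_finsetCard, Int.card_Icc]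
        exact_mod_cast (by omega : n ≤ ((n : ℤ) + 1 - 0).toNat)
    _ ≤ _ := Set.encard_le_encard hsub
    _ ≤ _ := Set.encard_image_le _ _

end Perc

/-- Consider site percolation on `ℤ²` with parameter `p` satisfying
`p_c < p ≤ 1`. Then there exist a constant `C > 0` and `n₀ ∈ ℕ` such that for all integers
`n ≥ n₀`, the `P_p`-probability that the box `{0,…,n} × {0,…,n}` contains an open cluster
(within the box) with at least `n` sites is at least `1 − exp(−C·n)`. -/
theorem supercritical_large_cluster (p : ℝ) (hpc : siteCriticalProbability < p)
    (hp1 : p ≤ 1) (μ : Measure Config) (hμ : IsBernoulliProduct p μ) :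
    ∃ C : ℝ, 0 < C ∧ ∃ n₀ : ℕ, ∀ n : ℕ, n₀ ≤ n →
      ENNReal.ofReal (1 - Real.exp (-C * n)) ≤
        μ {ω | ∃ v ∈ box0 n, (n : ℕ∞) ≤ (cluster ω (box0 n) v).encard} := by
  have := hμ.1
  have hp0 : 0 ≤ p := Perc.pc_nonneg.trans hpc.le
  obtain ⟨L, hL, hq⟩ := Perc.HC_start hpc hp1 hμ
  have hL0 : (0 : ℝ) < L := by exact_mod_cast hL
  refine ⟨1 / (2 * L), by positivity, L, fun n hn => ?_⟩
  have hne : (n + 1) / L ≠ 0 := by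
    have := Nat.div_pos (by omega : L ≤ n + 1) hL
    omega
  set j := Nat.log 2 ((n + 1) / L)
  have h1 : 2 ^ j * L ≤ n + 1 := (Nat.le_div_iff_mul_le hL).1 (Nat.pow_log_le_self 2 hne)
  have h2 : n + 1 < 2 ^ (j + 1) * L :=
    (Nat.div_lt_iff_lt_mul hL).1 (Nat.lt_pow_succ_log_self (by norm_num) _)
  have h3 := Perc.HC_exp hp0 hp1 hμ hL hq j
  have h4 : Real.exp (-2 ^ j) ≤ Real.exp (-(1 / (2 * L)) * n) := by
    refine Real.exp_le_exp.2 ?_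
    have : (n : ℝ) ≤ 2 ^ (j + 1) * L := by exact_mod_cast (by omega : n ≤ 2 ^ (j + 1) * L)
    rw [pow_succ] at this
    rw [neg_mul, neg_le_neg_iff, div_mul_eq_mul_div, one_mul, div_le_iff₀ (by positivity)]
    linarith
  have h5 : 1 - Real.exp (-(1 / (2 * L)) * n) ≤ μ.real (Perc.HC ((2 ^ j * L : ℕ) : ℤ)) := by
    have := Real.exp_pos (-2 ^ j)
    have := measureReal_le_one (μ := μ) (s := Perc.HC ((2 ^ j * L : ℕ) : ℤ))
    linarith
  refine (ENNReal.ofReal_le_ofReal h5).trans ?_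
  rw [measureReal_def, ENNReal.ofReal_toReal (measure_ne_top _ _)]
  refine measure_mono (fun ω hω => Perc.HC_cluster (L := ((2 ^ j * L : ℕ) : ℤ)) ?_ ?_ hω)
  · exact_mod_cast h1
  · rw [pow_succ] at h2
    have : 2 ^ j * 2 * L = 2 * (2 ^ j * L) := by ring
    omega
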